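/- arXiv:2403.06975 — 2 statements merged into one kernel-verified Lean document; each statement's English description precedes it below -/
import Mathlib

section
/- For positive integers m and n with n ≥ m-1, the Ehrhart polynomial of P(m,n) equals (1/2^m) sum_{i=0}^{⌊m/2⌋} sum_{j=2i}^{m} (-1)^{i+1} · (m! / ((m-j)!(j-2i)!(i!)^2)) · i! · (2j-4i-3)!! · t^{j-i} · (2nt+t+2)^{m-j}, where (2j-4i-3)!! = -prod_{k=1}^{j-2i}(2k-3). -/
open Pointwise

/-- The partial permutohedron `P(m,n) ⊆ ℝ^m`: the convex hull of all vectors in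
`{0,1,…,n}^m` whose nonzero entries are pairwise distinct. -/
noncomputable def partialPermutohedron (m n : ℕ) : Set (Fin m → ℝ) :=
  convexHull ℝ {x : Fin m → ℝ | ∃ y : Fin m → ℕ,
    (∀ i, y i ≤ n) ∧
    (∀ i j, i ≠ j → y i ≠ 0 → y j ≠ 0 → y i ≠ y j) ∧
    x = fun i => (y i : ℝ)}

section Excess

variable {ι : Type*}

/-- The largest value over `S ⊆ U` of `t * (|S| choose 2) + ∑ i ∈ S, (s i - y i)`. -/
noncomputable def excess (t : ℕ) (U : Finset ι) (s y : ι → ℤ) : ℤ :=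
  U.powerset.sup' ⟨∅, Finset.empty_mem_powerset U⟩
    fun S => (t : ℤ) * (S.card.choose 2 : ℕ) + ∑ i ∈ S, (s i - y i)

theorem le_excess (t : ℕ) {U S : Finset ι} (hS : S ⊆ U) (s y : ι → ℤ) :
    (t : ℤ) * (S.card.choose 2 : ℕ) + ∑ i ∈ S, (s i - y i) ≤ excess t U s y :=
  Finset.le_sup' (fun S : Finset ι => (t : ℤ) * (S.card.choose 2 : ℕ) + ∑ i ∈ S, (s i - y i))
    (Finset.mem_powerset.2 hS)

theorem excess_le_iff (t : ℕ) (U : Finset ι) (s y : ι → ℤ) (a : ℤ) :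
    excess t U s y ≤ a ↔
      ∀ S ⊆ U, (t : ℤ) * (S.card.choose 2 : ℕ) + ∑ i ∈ S, (s i - y i) ≤ a :=
  (Finset.sup'_le_iff _ _).trans (by simp only [Finset.mem_powerset])

theorem exists_eq_excess (t : ℕ) (U : Finset ι) (s y : ι → ℤ) :
    ∃ S ⊆ U, excess t U s y = (t : ℤ) * (S.card.choose 2 : ℕ) + ∑ i ∈ S, (s i - y i) := by
  obtain ⟨S, hS, h⟩ := Finset.exists_mem_eq_sup' (s := U.powerset)
    ⟨∅, Finset.empty_mem_powerset U⟩
    (fun S => (t : ℤ) * (S.card.choose 2 : ℕ) + ∑ i ∈ S, (s i - y i))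
  exact ⟨S, Finset.mem_powerset.1 hS, h⟩

theorem excess_nonneg (t : ℕ) (U : Finset ι) (s y : ι → ℤ) : 0 ≤ excess t U s y := by
  simpa using le_excess t (Finset.empty_subset U) s y

theorem excess_congr (t : ℕ) {U : Finset ι} {s s' y y' : ι → ℤ} (hs : ∀ i ∈ U, s i = s' i)
    (hy : ∀ i ∈ U, y i = y' i) : excess t U s y = excess t U s' y' := by
  refine Finset.sup'_congr _ rfl fun S hS => ?_
  rw [Finset.sum_congr rfl fun i hi => ?_]
  have := Finset.mem_powerset.1 hS hi
  rw [hs i this, hy i this]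

theorem excess_add_le (t : ℕ) (U : Finset ι) (s y : ι → ℤ) :
    excess t U (fun i => s i + t) y ≤ excess t U s y + t * U.card := by
  rw [excess_le_iff]
  intro S hS
  have h1 := le_excess t hS s y
  have h2 : (t : ℤ) * S.card ≤ t * U.card := by
    exact_mod_cast Nat.mul_le_mul_left t (Finset.card_le_card hS)
  simp only [Finset.sum_sub_distrib, Finset.sum_add_distrib, Finset.sum_const,
    nsmul_eq_mul] at h1 ⊢
  linarith

theorem excess_empty (t : ℕ) (s y : ι → ℤ) : excess t ∅ s y = 0 :=
  le_antisymm ((excess_le_iff t ∅ s y 0).2 fun S hS => by simp [Finset.subset_empty.1 hS])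
    (excess_nonneg t ∅ s y)

variable [DecidableEq ι]

theorem excess_insert (t : ℕ) {U : Finset ι} {u : ι} (hu : u ∉ U) (s y : ι → ℤ) :
    excess t (insert u U) s y =
      max (excess t U s y) (s u - y u + excess t U (fun i => s i + t) y) := by
  have key : ∀ S ⊆ U, (t : ℤ) * ((insert u S).card.choose 2 : ℕ) +
      ∑ i ∈ insert u S, (s i - y i) = s u - y u +
        ((t : ℤ) * (S.card.choose 2 : ℕ) + ∑ i ∈ S, (s i + t - y i)) := by
    intro S hS
    have h : u ∉ S := fun h => hu (hS h)
    rw [Finset.card_insert_of_notMem h, Finset.sum_insert h, Nat.choose_succ_succ' S.card 1]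
    simp only [Finset.sum_sub_distrib, Finset.sum_add_distrib, Finset.sum_const, nsmul_eq_mul]
    push_cast [Nat.choose_one_right]
    ring
  apply le_antisymm
  · rw [excess_le_iff]
    intro S hS
    by_cases h : u ∈ S
    · have h1 : S.erase u ⊆ U := fun i hi => by
        have := hS (Finset.mem_of_mem_erase hi)
        exact (Finset.mem_insert.1 this).resolve_left (Finset.ne_of_mem_erase hi)
      have h2 := key _ h1
      rw [Finset.insert_erase h] at h2
      rw [h2]
      exact le_max_of_le_right (by linarith [le_excess t h1 (fun i => s i + t) y])
    · have h1 : S ⊆ U := fun i hi =>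
        (Finset.mem_insert.1 (hS hi)).resolve_left fun h' => h (h' ▸ hi)
      exact le_max_of_le_left (le_excess t h1 s y)
  · apply max_le
    · rw [excess_le_iff]
      exact fun S hS => le_excess t (hS.trans (Finset.subset_insert _ _)) s y
    · obtain ⟨S, hS, h⟩ := exists_eq_excess t U (fun i => s i + t) y
      rw [h, ← key S hS]
      exact le_excess t (Finset.insert_subset_insert u hS) s y

theorem choose_two_add_le {a b c d : ℕ} (h : c + d = a + b) (ha : a ≤ c) (hb : b ≤ c) :
    a.choose 2 + b.choose 2 ≤ c.choose 2 + d.choose 2 := by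
  have h0 : (0 : ℚ) ≤ (c - a) * (c - b) := by
    have h1 : (a : ℚ) ≤ c := by exact_mod_cast ha
    have h2 : (b : ℚ) ≤ c := by exact_mod_cast hb
    exact mul_nonneg (by linarith) (by linarith)
  have h3 : (d : ℚ) = a + b - c := by
    have : (c : ℚ) + d = a + b := by exact_mod_cast h
    linarith
  have : ((a.choose 2 + b.choose 2 : ℕ) : ℚ) ≤ ((c.choose 2 + d.choose 2 : ℕ) : ℚ) := by
    push_cast
    rw [Nat.cast_choose_two, Nat.cast_choose_two, Nat.cast_choose_two, Nat.cast_choose_two, h3]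
    nlinarith
  exact_mod_cast this

theorem excess_superadditive (t : ℕ) {U : Finset ι} {s y : ι → ℤ} (hs : ∀ i ∈ U, 0 ≤ s i)
    (hy : excess t U 0 y ≤ 0) :
    excess t U s y + excess t U (fun _ => t) y ≤ excess t U (fun i => s i + t) y := by
  obtain ⟨A, hA, h1⟩ := exists_eq_excess t U s y
  obtain ⟨B, hB, h2⟩ := exists_eq_excess t U (fun _ => (t : ℤ)) y
  have h3 := le_excess t (Finset.union_subset hA hB) (fun i => s i + t) y
  have h4 := (le_excess t ((Finset.inter_subset_left (s₂ := B)).trans hA) 0 y).trans hy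
  have h5 : (t : ℤ) * (A.card.choose 2 : ℕ) + t * (B.card.choose 2 : ℕ) ≤
      t * ((A ∪ B).card.choose 2 : ℕ) + t * ((A ∩ B).card.choose 2 : ℕ) := by
    exact_mod_cast (by
      rw [← mul_add, ← mul_add]
      exact Nat.mul_le_mul_left t (choose_two_add_le (Finset.card_union_add_card_inter A B)
        (Finset.card_le_card Finset.subset_union_left)
        (Finset.card_le_card Finset.subset_union_right)) :
      t * (A.card.choose 2) + t * (B.card.choose 2) ≤
        t * ((A ∪ B).card.choose 2) + t * ((A ∩ B).card.choose 2))
  have h6 : ∑ i ∈ A, s i ≤ ∑ i ∈ A ∪ B, s i :=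
    Finset.sum_le_sum_of_subset_of_nonneg Finset.subset_union_left
      fun i hi _ => hs i (Finset.union_subset hA hB hi)
  have h7 : (t : ℤ) * B.card ≤ t * (A ∪ B).card := by
    exact_mod_cast Nat.mul_le_mul_left t (Finset.card_le_card Finset.subset_union_right)
  have h8 := Finset.sum_union_inter (s₁ := A) (s₂ := B) (f := y)
  rw [h1, h2]
  simp only [Finset.sum_sub_distrib, Finset.sum_add_distrib, Finset.sum_const, nsmul_eq_mul,
    Pi.zero_apply, zero_sub,
    Finset.sum_neg_distrib] at h3 h4 ⊢
  linarith

variable [Fintype ι]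

/-- Integer vectors supported in `U` with entries in `[0, b)`. -/
noncomputable def box (b : ℕ) (U : Finset ι) : Finset (ι → ℤ) :=
  Fintype.piFinset fun i => if i ∈ U then Finset.Ico 0 (b : ℤ) else {0}

/-- The vectors `y` of the box with `t * (|S| choose 2) ≤ ∑ i ∈ S, y i` for all `S ⊆ U`. -/
noncomputable def feasible (t b : ℕ) (U : Finset ι) : Finset (ι → ℤ) :=
  (box b U).filter fun y => excess t U 0 y ≤ 0

theorem sum_box_insert (b : ℕ) {U : Finset ι} {u : ι} (hu : u ∉ U) (f : (ι → ℤ) → ℚ) :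
    ∑ y ∈ box b (insert u U), f y =
      ∑ y ∈ box b U, ∑ z ∈ Finset.Ico 0 (b : ℤ), f (Function.update y u z) := by
  rw [← Finset.sum_product']
  refine (Finset.sum_bij' (fun p _ => Function.update p.1 u p.2)
    (fun y _ => (Function.update y u 0, y u)) ?_ ?_ ?_ ?_ ?_).symm
  · rintro ⟨y, z⟩ h
    simp only [Finset.mem_product, box, Fintype.mem_piFinset] at h ⊢
    intro i
    by_cases hi : i = u
    · subst hi; simpa using h.2
    · simpa [hi] using h.1 i
  · intro y h
    simp only [Finset.mem_product, box, Fintype.mem_piFinset] at h ⊢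
    refine ⟨fun i => ?_, by simpa using h u⟩
    by_cases hi : i = u
    · subst hi; simp [hu]
    · simpa [hi] using h i
  · rintro ⟨y, z⟩ h
    simp only [Finset.mem_product, box, Fintype.mem_piFinset] at h
    have := h.1 u
    simp only [hu, if_false, Finset.mem_singleton] at this
    simp [← this]
  · intro y _
    simp
  · intros; rfl

theorem sum_feasible_insert (t b : ℕ) {U : Finset ι} {u : ι} (hu : u ∉ U)
    (f : (ι → ℤ) → ℚ) :
    ∑ y ∈ feasible t b (insert u U), f y =
      ∑ y ∈ feasible t b U, ∑ z ∈ Finset.Ico (excess t U (fun _ => t) y) (b : ℤ),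
        f (Function.update y u z) := by
  rw [feasible, Finset.sum_filter, sum_box_insert b hu, feasible, Finset.sum_filter]
  refine Finset.sum_congr rfl fun y _ => ?_
  have h1 : ∀ z : ℤ, excess t (insert u U) 0 (Function.update y u z) =
      max (excess t U 0 y) (excess t U (fun _ => t) y - z) := by
    intro z
    have h : ∀ i ∈ U, Function.update y u z i = y i := fun i hi =>
      Function.update_of_ne (ne_of_mem_of_not_mem hi hu) _ _
    rw [excess_insert t hu, excess_congr t (fun _ _ => rfl) h,
      excess_congr t (s' := fun _ => (t : ℤ)) (fun _ _ => by simp) h]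
    simp only [Pi.zero_apply, Function.update_self]
    congr 1
    ring
  simp only [h1, max_le_iff]
  by_cases hy : excess t U 0 y ≤ 0
  · simp only [hy, true_and, if_true]
    rw [← Finset.sum_filter]
    refine Finset.sum_congr ?_ fun _ _ => rfl
    ext z
    have := excess_nonneg t U (fun _ => (t : ℤ)) y
    simp only [Finset.mem_filter, Finset.mem_Ico]
    constructor
    · rintro ⟨⟨_, _⟩, _⟩; constructor <;> linarith
    · rintro ⟨_, _⟩; refine ⟨⟨?_, ?_⟩, ?_⟩ <;> linarith
  · simp [hy]

/-- The total excess of the feasible vectors. -/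
noncomputable def totalExcess (t b : ℕ) (U : Finset ι) (s : ι → ℤ) : ℚ :=
  ∑ y ∈ feasible t b U, (excess t U s y : ℚ)

theorem excess_const_le {t b : ℕ} {U : Finset ι} {y : ι → ℤ} (hy : y ∈ feasible t b U) :
    excess t U (fun _ => (t : ℤ)) y ≤ t * U.card := by
  have h := excess_add_le t U 0 y
  have h0 := (Finset.mem_filter.1 hy).2
  simp only [Pi.zero_apply, zero_add] at h
  linarith

theorem card_feasible_insert {t b : ℕ} {U : Finset ι} {u : ι} (hu : u ∉ U)
    (hb : t * U.card ≤ b) :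
    ((feasible t b (insert u U)).card : ℚ) =
      b * (feasible t b U).card - totalExcess t b U fun _ => t := by
  have h := sum_feasible_insert t b hu fun _ => 1
  simp only [Finset.sum_const, nsmul_eq_mul, mul_one, Int.card_Ico] at h
  rw [h, totalExcess, mul_comm, ← nsmul_eq_mul, ← Finset.sum_const, ← Finset.sum_sub_distrib]
  refine Finset.sum_congr rfl fun y hy => ?_
  have h1 := excess_const_le hy
  have h2 : (t : ℤ) * U.card ≤ b := by exact_mod_cast hb
  have h3 : (((b - excess t U (fun _ => (t : ℤ)) y).toNat : ℤ) : ℚ) =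
      ((b - excess t U (fun _ => (t : ℤ)) y : ℤ) : ℚ) := by
    rw [Int.toNat_of_nonneg (by linarith)]
  push_cast at h3 ⊢
  exact h3

theorem sum_Ico_posPart {p q b : ℤ} (hpq : p ≤ q) (hqb : q ≤ b) :
    ∑ z ∈ Finset.Ico p b, ((max 0 (q - z) : ℤ) : ℚ) = (q - p) * (q - p + 1) / 2 := by
  have h1 : ∑ z ∈ Finset.Ico p b, ((max 0 (q - z) : ℤ) : ℚ) =
      ∑ z ∈ Finset.Ico p q, ((q - z : ℤ) : ℚ) := by
    rw [← Finset.sum_subset (Finset.Ico_subset_Ico_right hqb)]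
    · refine Finset.sum_congr rfl fun z hz => ?_
      rw [max_eq_right]
      linarith [(Finset.mem_Ico.1 hz).2]
    · intro z hz hz'
      simp only [Finset.mem_Ico, not_and, not_lt] at hz hz'
      rw [max_eq_left (by linarith [hz' hz.1])]
      simp
  rw [h1]
  clear h1 hqb
  induction q, hpq using Int.leInduction with
  | base => simp
  | succ q hq ih =>
    have h2 : Finset.Ico p (q + 1) = insert q (Finset.Ico p q) := by
      ext z; simp only [Finset.mem_Ico, Finset.mem_insert]; omega
    have h3 : ∀ z : ℤ, ((q + 1 - z : ℤ) : ℚ) = ((q - z : ℤ) : ℚ) + 1 := by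
      intro z; push_cast; ring
    rw [h2, Finset.sum_insert (by simp)]
    simp only [h3, Finset.sum_add_distrib, ih, Finset.sum_const, nsmul_eq_mul, Int.card_Ico]
    have h4 : (((q - p).toNat : ℤ) : ℚ) = ((q - p : ℤ) : ℚ) := by
      rw [Int.toNat_of_nonneg (by linarith)]
    push_cast at h4 ⊢
    rw [h4]
    ring

theorem totalExcess_insert {t b : ℕ} {U : Finset ι} {u : ι} (hu : u ∉ U) {s : ι → ℤ}
    (hs : ∀ i, 0 ≤ s i) (hb : s u + t * U.card ≤ b) :
    totalExcess t b (insert u U) s = totalExcess t b (insert u U) (Function.update s u 0) +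
      s u * (s u + 1) / 2 * (feasible t b U).card +
      s u * (totalExcess t b U (fun i => s i + t) - totalExcess t b U s -
        totalExcess t b U fun _ => t) := by
  have h0 : ∀ (s : ι → ℤ) (y : ι → ℤ) (z : ℤ),
      excess t (insert u U) s (Function.update y u z) =
        excess t U s y + max 0 (s u + excess t U (fun i => s i + t) y - excess t U s y - z) := by
    intro s y z
    have h : ∀ i ∈ U, Function.update y u z i = y i := fun i hi =>
      Function.update_of_ne (ne_of_mem_of_not_mem hi hu) _ _
    rw [excess_insert t hu, excess_congr t (fun _ _ => rfl) h,
      excess_congr t (fun _ _ => rfl) h]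
    simp only [Function.update_self]
    rw [← max_add_add_left]
    congr 1 <;> ring
  have hupd : ∀ i ∈ U, Function.update s u 0 i = s i := fun i hi =>
      Function.update_of_ne (ne_of_mem_of_not_mem hi hu) _ _
  simp only [totalExcess]
  rw [sum_feasible_insert t b hu, sum_feasible_insert t b hu, ← Finset.sum_sub_distrib,
    ← Finset.sum_sub_distrib, Finset.mul_sum, mul_comm _ ((feasible t b U).card : ℚ),
    ← nsmul_eq_mul, ← Finset.sum_const, ← Finset.sum_add_distrib, ← Finset.sum_add_distrib]
  refine Finset.sum_congr rfl fun y hy => ?_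
  have h1 : excess t U (Function.update s u 0) y = excess t U s y :=
    excess_congr t hupd fun _ _ => rfl
  have h2 : excess t U (fun i => Function.update s u 0 i + t) y =
      excess t U (fun i => s i + t) y :=
    excess_congr t (fun i hi => by rw [hupd i hi]) fun _ _ => rfl
  simp only [h0, h1, h2, Function.update_self, zero_add, Int.cast_add, Finset.sum_add_distrib]
  have h3 := excess_superadditive t (fun i _ => hs i) (Finset.mem_filter.1 hy).2
  have h4 := excess_add_le t U s y
  have h5 := hs u
  rw [sum_Ico_posPart (by linarith) (by linarith), sum_Ico_posPart (by linarith) (by linarith)]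
  push_cast
  ring

theorem totalExcess_congr (t b : ℕ) {U : Finset ι} {s s' : ι → ℤ} (hs : ∀ i ∈ U, s i = s' i) :
    totalExcess t b U s = totalExcess t b U s' :=
  Finset.sum_congr rfl fun y _ => by rw [excess_congr t hs fun _ _ => rfl]

theorem totalExcess_zero (t b : ℕ) (U : Finset ι) : totalExcess t b U 0 = 0 :=
  Finset.sum_eq_zero fun y hy => by
    rw [le_antisymm (Finset.mem_filter.1 hy).2 (excess_nonneg t U 0 y), Int.cast_zero]

theorem totalExcess_eq_of_card {t b k : ℕ} {f B : ℕ → ℚ}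
    (hB : B (k + 2) = t * (f k + k * B (k + 1)))
    (hF : ∀ W : Finset ι, W.card = k + 1 → ((feasible t b W).card : ℚ) = f (k + 1))
    (ih : ∀ W : Finset ι, W.card = k + 1 → ∀ s : ι → ℤ, (∀ i, 0 ≤ s i) →
      (∀ i ∈ W, s i + t * k ≤ b) → totalExcess t b W s =
        f k * (∑ i ∈ W, (s i * (s i + 1) / 2 : ℚ)) +
        B (k + 1) * (((∑ i ∈ W, (s i : ℚ)) ^ 2 - ∑ i ∈ W, (s i : ℚ) ^ 2) / 2))
    {U : Finset ι} (hU : U.card = k + 2) {s : ι → ℤ} (hs : ∀ i, 0 ≤ s i)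
    (hb : ∀ i ∈ U, s i + t * (k + 1) ≤ b) :
    totalExcess t b U s =
      f (k + 1) * (∑ i ∈ U, (s i * (s i + 1) / 2 : ℚ)) +
      B (k + 2) * (((∑ i ∈ U, (s i : ℚ)) ^ 2 - ∑ i ∈ U, (s i : ℚ) ^ 2) / 2) := by
  have main : ∀ T ⊆ U, totalExcess t b U (fun i => if i ∈ T then s i else 0) =
      f (k + 1) * (∑ i ∈ T, (s i * (s i + 1) / 2 : ℚ)) +
      B (k + 2) * (((∑ i ∈ T, (s i : ℚ)) ^ 2 - ∑ i ∈ T, (s i : ℚ) ^ 2) / 2) := by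
    intro T
    induction T using Finset.induction_on with
    | empty => intro _; simpa using! totalExcess_zero t b U
    | insert u T hu ihT =>
      intro hT
      have huU : u ∈ U := hT (Finset.mem_insert_self u T)
      have hTU : T ⊆ U.erase u := fun i hi => Finset.mem_erase.2
        ⟨ne_of_mem_of_not_mem hi hu, hT (Finset.mem_insert_of_mem hi)⟩
      have hW : (U.erase u).card = k + 1 := by rw [Finset.card_erase_of_mem huU, hU]; rfl
      set s' : ι → ℤ := fun i => if i ∈ insert u T then s i else 0 with hs'
      have hs'0 : ∀ i, 0 ≤ s' i := fun i => by
        simp only [hs']; split_ifs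
        exacts [hs i, le_rfl]
      have hs'u : s' u = s u := by simp [hs']
      have hs'le : ∀ i, s' i ≤ s i := fun i => by
        simp only [hs']; split_ifs
        exacts [le_rfl, hs i]
      have hupd : Function.update s' u 0 = fun i => if i ∈ T then s i else 0 := by
        ext i
        by_cases hi : i = u
        · subst hi; simp [hu]
        · simp [hs', hi]
      have ht0 : (0 : ℤ) ≤ t := Int.natCast_nonneg t
      have h1 := totalExcess_insert (t := t) (b := b) (Finset.notMem_erase u U) hs'0
        (by rw [hW, hs'u]; exact_mod_cast hb u huU)
      have hb' : ∀ i ∈ U.erase u, s' i + t * (k + 1) ≤ b := fun i hi => by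
        linarith [hb i (Finset.mem_of_mem_erase hi), hs'le i]
      rw [Finset.insert_erase huU, hupd, ihT ((Finset.subset_insert _ _).trans hT), hs'u,
        hF _ hW, ih _ hW (fun i => s' i + t) (fun i => by linarith [hs'0 i])
          (fun i hi => by linarith [hb' i hi]),
        ih _ hW s' hs'0 (fun i hi => by linarith [hb' i hi]),
        ih _ hW (fun _ => t) (fun _ => ht0)
          (fun i hi => by linarith [hb' i hi, hs'0 i])] at h1
      have h2 : ∑ i ∈ U.erase u, (s' i : ℚ) = ∑ i ∈ T, (s i : ℚ) := by
        rw [← Finset.sum_subset hTU]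
        · exact Finset.sum_congr rfl fun i hi => by simp [hs', hi]
        · intro i hi hi'
          simp [hs', hi', Finset.ne_of_mem_erase hi]
      rw [h1, Finset.sum_insert hu, Finset.sum_insert hu, Finset.sum_insert hu, hB]
      have e1 : ∀ i, (((s' i + t : ℤ) : ℚ) * (((s' i + t : ℤ) : ℚ) + 1) / 2) =
          (s' i : ℚ) * (s' i + 1) / 2 + t * s' i + t * (t + 1) / 2 := by
        intro i; push_cast; ring
      have e2 : ∀ i, ((s' i + t : ℤ) : ℚ) ^ 2 = (s' i : ℚ) ^ 2 + 2 * t * s' i + t ^ 2 := by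
        intro i; push_cast; ring
      simp only [e1, e2]
      simp only [Int.cast_add, Int.cast_natCast, Finset.sum_add_distrib, Finset.sum_const, hW,
        nsmul_eq_mul, ← Finset.mul_sum, h2]
      push_cast
      ring
  rw [← main U subset_rfl]
  exact totalExcess_congr t b fun i hi => by simp [hi]

theorem card_feasible_empty (t b : ℕ) : (feasible t b (∅ : Finset ι)).card = 1 := by
  have h : feasible t b (∅ : Finset ι) = box b ∅ :=
    Finset.filter_true_of_mem fun y _ => (excess_empty t 0 y).le
  simp [h, box]

theorem totalExcess_singleton {t b : ℕ} (u : ι) {s : ι → ℤ} (hs : ∀ i, 0 ≤ s i)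
    (hb : s u ≤ b) : totalExcess t b {u} s = s u * (s u + 1) / 2 := by
  have h0 : ∀ s : ι → ℤ, totalExcess t b ∅ s = 0 := fun s =>
    Finset.sum_eq_zero fun y _ => by rw [excess_empty, Int.cast_zero]
  have h := totalExcess_insert (t := t) (b := b) (Finset.notMem_empty u) hs (by simpa using hb)
  have h1 : totalExcess t b {u} (Function.update s u 0) = 0 := by
    rw [← totalExcess_zero t b {u}]
    exact totalExcess_congr t b fun i hi => by
      rw [Finset.mem_singleton.1 hi]; simp
  rw [insert_empty_eq, h1, card_feasible_empty, h0, h0, h0] at h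
  rw [h]
  push_cast
  ring

theorem feasible_totalExcess_eq {t b : ℕ} {f B : ℕ → ℚ} (hf0 : f 0 = 1) (hf1 : f 1 = b)
    (hB1 : ∀ k, B (k + 2) = t * (f k + k * B (k + 1)))
    (hf : ∀ k : ℕ, f (k + 2) = b * f (k + 1) - (k + 1) * (t * (t + 1) / 2) * f k -
      (k + 1) * k / 2 * t ^ 2 * B (k + 1)) (k : ℕ) :
    (∀ W : Finset ι, W.card = k + 1 → t * k ≤ b → ((feasible t b W).card : ℚ) = f (k + 1)) ∧
    ∀ W : Finset ι, W.card = k + 1 → ∀ s : ι → ℤ, (∀ i, 0 ≤ s i) →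
      (∀ i ∈ W, s i + t * k ≤ b) → totalExcess t b W s =
        f k * (∑ i ∈ W, (s i * (s i + 1) / 2 : ℚ)) +
        B (k + 1) * (((∑ i ∈ W, (s i : ℚ)) ^ 2 - ∑ i ∈ W, (s i : ℚ) ^ 2) / 2) := by
  induction k with
  | zero =>
    constructor
    · intro W hW _
      obtain ⟨u, rfl⟩ := Finset.card_eq_one.1 hW
      have h := card_feasible_insert (t := t) (b := b) (Finset.notMem_empty u) (by simp)
      rw [insert_empty_eq, card_feasible_empty] at h
      rw [h, hf1]
      simp [totalExcess, excess_empty]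
    · intro W hW s hs hb
      obtain ⟨u, rfl⟩ := Finset.card_eq_one.1 hW
      rw [totalExcess_singleton u hs (by simpa using hb u)]
      simp [hf0]
  | succ k ih =>
    constructor
    · intro W hW hb
      obtain ⟨u, U, hu, rfl, hU⟩ := Finset.card_eq_succ.1 hW
      have hb' : t * k ≤ b := (Nat.mul_le_mul_left t k.le_succ).trans hb
      rw [card_feasible_insert hu (by rwa [hU]), ih.1 U hU hb',
        ih.2 U hU _ (fun _ => Int.natCast_nonneg t)
          (fun i _ => by have : (t * (k + 1) : ℤ) ≤ b := by exact_mod_cast hb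
                         linarith), hf k]
      simp only [Finset.sum_const, hU, nsmul_eq_mul]
      push_cast
      ring
    · intro U hU s hs hb
      by_cases hb' : t * k ≤ b
      · exact totalExcess_eq_of_card (hB1 k) (fun W hW => ih.1 W hW hb') ih.2 hU hs
          (fun i hi => by have := hb i hi; push_cast at this; exact this)
      · obtain ⟨i, hi⟩ : U.Nonempty := Finset.card_pos.1 (by omega)
        have h1 := hb i hi
        have h2 := hs i
        have h3 : (b : ℤ) < t * k := by exact_mod_cast not_le.1 hb'
        have h4 : (0 : ℤ) ≤ t := Int.natCast_nonneg t
        push_cast at h1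
        linarith

end Excess

section Series

open PowerSeries

/-- The power series `exp (a z)`. -/
noncomputable def expSeries (a : ℚ) : PowerSeries ℚ := .mk fun k => a ^ k / k.factorial

/-- The power series `√(1 - t z)`. -/
noncomputable def sqrtSeries (t : ℚ) : PowerSeries ℚ :=
  .mk fun l => (∏ k ∈ Finset.range l, (2 * (k : ℚ) - 1)) * (t / 2) ^ l / l.factorial

/-- The power series `exp (- t z ^ 2 / 4)`. -/
noncomputable def gaussSeries (t : ℚ) : PowerSeries ℚ :=
  .mk fun k => if k % 2 = 0 then (-(t / 4)) ^ (k / 2) / (k / 2).factorial else 0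

theorem derivative_expSeries (a : ℚ) : d⁄dX ℚ (expSeries a) = C a * expSeries a := by
  ext k
  have h : ((k : ℚ) + 1) ≠ 0 := by positivity
  have h2 : (k.factorial : ℚ) ≠ 0 := by positivity
  simp only [coeff_derivative, coeff_C_mul, expSeries, coeff_mk, Nat.factorial_succ]
  push_cast
  field_simp
  ring

theorem derivative_sqrtSeries (t : ℚ) :
    d⁄dX ℚ (sqrtSeries t) = X * (C t * d⁄dX ℚ (sqrtSeries t)) - C (t / 2) * sqrtSeries t := by
  ext k
  have h : ((k : ℚ) + 1) ≠ 0 := by positivity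
  have h2 : (k.factorial : ℚ) ≠ 0 := by positivity
  rw [map_sub]
  cases k with
  | zero => simp [coeff_derivative, sqrtSeries]
  | succ k =>
    simp only [coeff_succ_X_mul, coeff_derivative, coeff_C_mul, sqrtSeries, coeff_mk,
      Nat.factorial_succ, Finset.prod_range_succ] at h h2 ⊢
    push_cast at h h2 ⊢
    field_simp
    ring

theorem derivative_gaussSeries (t : ℚ) :
    d⁄dX ℚ (gaussSeries t) = X * (C (-(t / 2)) * gaussSeries t) := by
  ext k
  cases k with
  | zero => simp [coeff_derivative, gaussSeries]
  | succ k =>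
    simp only [coeff_succ_X_mul, coeff_derivative, coeff_C_mul, gaussSeries, coeff_mk]
    rcases Nat.even_or_odd' k with ⟨c, rfl | rfl⟩
    · have h1 : (2 * c + 1 + 1) % 2 = 0 := by omega
      have h2 : (2 * c + 1 + 1) / 2 = c + 1 := by omega
      have h3 : (2 * c) / 2 = c := by omega
      have h : ((c : ℚ) + 1) ≠ 0 := by positivity
      have h' : (c.factorial : ℚ) ≠ 0 := by positivity
      simp only [h1, h2, h3, Nat.mul_mod_right, if_true, Nat.factorial_succ]
      push_cast
      field_simp
      ring
    · have h1 : (2 * c + 1 + 1 + 1) % 2 = 1 := by omega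
      have h2 : (2 * c + 1) % 2 = 1 := by omega
      simp [h1, h2]

/-- The exponential generating function of the numbers of lattice points. -/
noncomputable def ehrhartSeries (t b : ℚ) : PowerSeries ℚ :=
  gaussSeries t * (sqrtSeries t * expSeries (b + t / 2))

theorem derivative_ehrhartSeries (t b : ℚ) :
    d⁄dX ℚ (ehrhartSeries t b) = C b * ehrhartSeries t b -
      X * (C (b * t + t * (t + 1) / 2) * ehrhartSeries t b) +
      X * (X * (C (t ^ 2 / 2) * ehrhartSeries t b)) +
      X * (C t * d⁄dX ℚ (ehrhartSeries t b)) := by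
  have h1 := derivative_expSeries (b + t / 2)
  have h2 := derivative_sqrtSeries t
  have h3 := derivative_gaussSeries t
  have h : d⁄dX ℚ (ehrhartSeries t b) =
      gaussSeries t * (sqrtSeries t * d⁄dX ℚ (expSeries (b + t / 2)) +
        expSeries (b + t / 2) * d⁄dX ℚ (sqrtSeries t)) +
      sqrtSeries t * expSeries (b + t / 2) * d⁄dX ℚ (gaussSeries t) := by
    simp only [ehrhartSeries, Derivation.leibniz, smul_eq_mul]
  have c1 : (C (b + t / 2) : PowerSeries ℚ) = C b + C (t / 2) := map_add _ _ _
  have c2 : (C (b * t + t * (t + 1) / 2) : PowerSeries ℚ) =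
      C b * C t + C t * C (t / 2) + C (t / 2) := by
    rw [← map_mul, ← map_mul, ← map_add, ← map_add]; congr 1; ring
  have c3 : (C (t ^ 2 / 2) : PowerSeries ℚ) = C t * C (t / 2) := by
    rw [← map_mul]; congr 1; ring
  have c4 : (C (-(t / 2)) : PowerSeries ℚ) = - C (t / 2) := map_neg _ _
  rw [h, c2, c3, h1, h3, c1, c4, ehrhartSeries]
  linear_combination (gaussSeries t * expSeries (b + t / 2)) * h2

/-- The value of the Ehrhart polynomial at `t`, with `b = n * t + 1`. -/
noncomputable def ehrhartValue (t b : ℚ) (m : ℕ) : ℚ := m.factorial * coeff m (ehrhartSeries t b)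

theorem ehrhartValue_zero (t b : ℚ) : ehrhartValue t b 0 = 1 := by
  simp [ehrhartValue, ehrhartSeries, gaussSeries, sqrtSeries, expSeries]

theorem ehrhartValue_one (t b : ℚ) : ehrhartValue t b 1 = b := by
  have h := congrArg (coeff 0) (derivative_ehrhartSeries t b)
  have h0 := ehrhartValue_zero t b
  simp [ehrhartValue, coeff_derivative] at h h0 ⊢
  rw [h, h0, mul_one]

theorem ehrhartValue_two (t b : ℚ) :
    ehrhartValue t b 2 = b * b - t * (t + 1) / 2 := by
  have h := congrArg (coeff (0 + 1)) (derivative_ehrhartSeries t b)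
  have h0 := ehrhartValue_zero t b
  have h1 := ehrhartValue_one t b
  generalize hc : b * t + t * (t + 1) / 2 = c at h
  simp only [map_add, map_sub, coeff_succ_X_mul, coeff_C_mul, coeff_derivative,
    coeff_zero_X_mul] at h
  simp only [ehrhartValue, Nat.factorial, Nat.cast_one, one_mul, mul_one, zero_add, Nat.cast_zero,
    Nat.reduceAdd, Nat.succ_eq_add_one] at h h0 h1 ⊢
  rw [h1, h0] at h
  push_cast
  linear_combination h + hc

theorem ehrhartValue_add_three (t b : ℚ) (m : ℕ) :
    ehrhartValue t b (m + 3) = (t * (m + 2) + b) * ehrhartValue t b (m + 2) -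
      (m + 2) * (b * t + t * (t + 1) / 2) * ehrhartValue t b (m + 1) +
      t ^ 2 * ((m + 2) * (m + 1) / 2) * ehrhartValue t b m := by
  have h := congrArg (coeff (m + 2)) (derivative_ehrhartSeries t b)
  generalize hc : b * t + t * (t + 1) / 2 = c at h ⊢
  simp only [map_add, map_sub, coeff_succ_X_mul, coeff_C_mul, coeff_derivative,
    show m + 2 = m + 1 + 1 from rfl] at h
  simp only [ehrhartValue, show m + 3 = m + 2 + 1 from rfl, show m + 2 = m + 1 + 1 from rfl,
    Nat.factorial_succ]
  push_cast at h ⊢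
  linear_combination ((m : ℚ) + 2) * (m + 1) * m.factorial * h

/-- The coefficient of the pair sum in the formula for the total excess. -/
noncomputable def pairCoeff (t b : ℚ) : ℕ → ℚ
  | 0 => 0
  | 1 => 0
  | k + 2 => t * (ehrhartValue t b k + k * pairCoeff t b (k + 1))

theorem ehrhartValue_add_two (t b : ℚ) (k : ℕ) :
    ehrhartValue t b (k + 2) = b * ehrhartValue t b (k + 1) -
      (k + 1) * (t * (t + 1) / 2) * ehrhartValue t b k -
      (k + 1) * k / 2 * t ^ 2 * pairCoeff t b (k + 1) := by
  induction k with
  | zero => rw [ehrhartValue_two, ehrhartValue_one, ehrhartValue_zero]; simp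
  | succ k ih =>
    rw [ehrhartValue_add_three, pairCoeff]
    push_cast
    linear_combination t * (k + 2) * ih

theorem ehrhartValue_eq_sum (t b : ℚ) (m : ℕ) :
    ehrhartValue t b m = (1 / 2 ^ m) * ∑ i ∈ Finset.range (m / 2 + 1), ∑ j ∈ Finset.Icc (2 * i) m,
        (-1) ^ (i + 1) *
          ((m.factorial : ℚ) /
            ((m - j).factorial * (j - 2 * i).factorial * i.factorial ^ 2)) *
          i.factorial *
          (-(∏ k ∈ Finset.range (j - 2 * i), (2 * (k : ℚ) - 1))) *
          t ^ (j - i) * (2 * b + t) ^ (m - j) := by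
  have h1 : ∀ (P Q : PowerSeries ℚ) (n : ℕ),
      coeff n (P * Q) = ∑ i ∈ Finset.range (n + 1), coeff i P * coeff (n - i) Q := by
    intro P Q n
    rw [coeff_mul, Finset.Nat.sum_antidiagonal_eq_sum_range_succ fun i j => coeff i P * coeff j Q]
  rw [ehrhartValue, ehrhartSeries, h1, Finset.mul_sum, Finset.mul_sum]
  symm
  refine Finset.sum_of_injOn (fun i => 2 * i) (fun i _ j _ h => by simpa using h) ?_ ?_ ?_
  · intro i hi
    simp only [Finset.coe_range, Set.mem_Iio] at hi ⊢
    omega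
  · intro p hp hp'
    have : p % 2 ≠ 0 := by
      intro h
      apply hp'
      simp only [Finset.coe_range, Set.mem_image, Set.mem_Iio, Finset.mem_range] at hp ⊢
      exact ⟨p / 2, by omega, by omega⟩
    simp [gaussSeries, this]
  · intro i hi
    have hi' : 2 * i ≤ m := by have := Finset.mem_range.1 hi; omega
    rw [h1, Finset.mul_sum, Finset.mul_sum, Finset.mul_sum]
    refine Finset.sum_nbij' (fun j => j - 2 * i) (fun l => l + 2 * i) ?_ ?_ ?_ ?_ ?_
    · intro j hj; simp only [Finset.mem_Icc, Finset.mem_range] at hj ⊢; omega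
    · intro j hj; simp only [Finset.mem_Icc, Finset.mem_range] at hj ⊢; omega
    · intro j hj; simp only [Finset.mem_Icc] at hj ⊢; omega
    · intro j hj; simp only [Finset.mem_range] at hj ⊢; omega
    · intro j hj
      obtain ⟨hj1, hj2⟩ := Finset.mem_Icc.1 hj
      obtain ⟨l, rfl⟩ := Nat.exists_eq_add_of_le hj1
      obtain ⟨r, rfl⟩ := Nat.exists_eq_add_of_le hj2
      have e1 : 2 * i + l + r - (2 * i + l) = r := by omega
      have e2 : 2 * i + l - 2 * i = l := by omega
      have e3 : 2 * i + l - i = i + l := by omega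
      have e4 : 2 * i + l + r - 2 * i - l = r := by omega
      simp only [e1, e2, e3, e4, gaussSeries, sqrtSeries, expSeries, coeff_mk, Nat.mul_mod_right,
        if_true, Nat.mul_div_cancel_left i two_pos]
      have hi0 : (i.factorial : ℚ) ≠ 0 := by positivity
      have hl0 : (l.factorial : ℚ) ≠ 0 := by positivity
      have hr0 : (r.factorial : ℚ) ≠ 0 := by positivity
      have e5 : (b + t / 2) ^ r = (2 * b + t) ^ r / 2 ^ r := by
        rw [← div_pow]; congr 1; ring
      have e6 : (-(t / 4)) ^ i = (-1) ^ i * t ^ i / 2 ^ (2 * i) := by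
        rw [pow_mul, ← mul_pow, ← div_pow]; congr 1; ring
      rw [e5, e6, div_pow, pow_succ, pow_add t, pow_add, pow_add]
      field_simp

end Series

section Polytope

/-- A vector with distinct nonzero entries, all at most `n`, satisfies the facet inequalities. -/
theorem sum_le_of_injective_ne_zero {ι : Type*} {n : ℕ} {y : ι → ℕ}
    (hy : ∀ i, y i ≤ n) (hinj : ∀ i j, i ≠ j → y i ≠ 0 → y j ≠ 0 → y i ≠ y j)
    (S : Finset ι) (hS : S.card ≤ n + 1) :
    ∑ i ∈ S, y i + S.card.choose 2 ≤ n * S.card := by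
  classical
  induction h : S.card generalizing S with
  | zero => simp [Finset.card_eq_zero.1 h]
  | succ k ih =>
    obtain ⟨i, hi, hik⟩ : ∃ i ∈ S, y i + k ≤ n := by
      by_contra! hcon
      have hmap : ∀ i ∈ S, n - y i ∈ Finset.range k := fun i hi => by
        have := hcon i hi
        have := hy i
        rw [Finset.mem_range]; omega
      obtain ⟨i, hi, j, hj, hij, he⟩ :=
        Finset.exists_ne_map_eq_of_card_lt_of_maps_to (by simp [h]) hmap
      have h1 := hcon i hi
      have h2 := hcon j hj
      have h3 := hy i
      have h4 := hy j
      exact hinj i j hij (by omega) (by omega) (by omega)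
    have hc : (S.erase i).card = k := by rw [Finset.card_erase_of_mem hi, h]; rfl
    have h1 := ih (S.erase i) (by omega) hc
    have h2 := Finset.add_sum_erase S y hi
    have h3 : (k + 1).choose 2 = k + k.choose 2 := by
      rw [Nat.choose_succ_succ' k 1, Nat.choose_one_right]
    rw [h3, mul_add]
    omega

/-- Abel summation: weights that decrease to a nonnegative value preserve nonnegativity of
all partial sums. -/
theorem sum_antitone_mul_nonneg {a d : ℕ → ℝ} (ha : Antitone a) (ha0 : ∀ k, 0 ≤ a k) {m : ℕ}
    (hd : ∀ k ≤ m, 0 ≤ ∑ i ∈ Finset.range k, d i) : 0 ≤ ∑ i ∈ Finset.range m, a i * d i := by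
  have key : ∀ k ≤ m, a k * ∑ i ∈ Finset.range k, d i ≤ ∑ i ∈ Finset.range k, a i * d i := by
    intro k
    induction k with
    | zero => simp
    | succ k ih =>
      intro hk
      have h1 := ih (by omega)
      have h2 := mul_le_mul_of_nonneg_right (ha k.le_succ) (hd (k + 1) hk)
      rw [Finset.sum_range_succ] at h2 ⊢
      rw [Finset.sum_range_succ]
      linarith
  exact (mul_nonneg (ha0 m) (hd m le_rfl)).trans (key m le_rfl)

/-- The greedy vertex maximizes a linear functional over the region cut out by the facet
inequalities. -/
theorem exists_vertex_sum_le {m n : ℕ} (hn : m ≤ n + 1) (t : ℝ) {x : Fin m → ℝ}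
    (hx0 : ∀ i, 0 ≤ x i)
    (hx : ∀ S : Finset (Fin m), ∑ i ∈ S, x i ≤ t * (n * S.card - S.card.choose 2))
    (c : Fin m → ℝ) :
    ∃ y : Fin m → ℕ, (∀ i, y i ≤ n) ∧ (∀ i j, i ≠ j → y i ≠ 0 → y j ≠ 0 → y i ≠ y j) ∧
      ∑ i, x i * c i ≤ ∑ i, (t * y i) * c i := by
  classical
  set σ := Tuple.sort fun i => -c i with hσ
  have hanti : Antitone fun k => c (σ k) := fun i j hij => by
    have := Tuple.monotone_sort (fun i => -c i) hij
    simpa using this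
  refine ⟨fun i => if 0 < c i then n - (σ.symm i : ℕ) else 0, fun i => ?_, ?_, ?_⟩
  · dsimp only; split_ifs <;> omega
  · intro i j hij hi hj he
    simp only [ne_eq, ite_eq_right_iff, Classical.not_imp] at hi hj
    simp only [if_pos hi.1, if_pos hj.1] at he
    have h : (σ.symm i : ℕ) = σ.symm j := by omega
    exact hij (σ.symm.injective (Fin.ext h))
  · have hpos : ∑ i, x i * c i ≤ ∑ i, x i * max (c i) 0 :=
      Finset.sum_le_sum fun i _ => mul_le_mul_of_nonneg_left (le_max_left _ _) (hx0 i)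
    refine hpos.trans (sub_nonneg.1 ?_)
    rw [← Finset.sum_sub_distrib, ← Equiv.sum_comp σ]
    let a : ℕ → ℝ := fun k => if h : k < m then max (c (σ ⟨k, h⟩)) 0 else 0
    let X : ℕ → ℝ := fun k => if h : k < m then x (σ ⟨k, h⟩) else 0
    have hterm : ∀ k : Fin m,
        t * ((if 0 < c (σ k) then n - (σ.symm (σ k) : ℕ) else 0 : ℕ) : ℝ) * c (σ k) -
          x (σ k) * max (c (σ k)) 0 = a k * (t * ((n : ℝ) - (k : ℕ)) - X k) := by
      intro k
      have hk : (k : ℕ) ≤ n := by have := k.isLt; omega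
      simp only [a, X, k.isLt, dif_pos, Equiv.symm_apply_apply, Fin.eta]
      split_ifs with h
      · rw [max_eq_left h.le, Nat.cast_sub hk]; ring
      · rw [max_eq_right (not_lt.1 h)]; simp
    simp only [hterm]
    rw [Fin.sum_univ_eq_sum_range fun k => a k * (t * ((n : ℝ) - k) - X k)]
    refine sum_antitone_mul_nonneg ?_ ?_ ?_
    · intro i j hij
      simp only [a]
      split_ifs with h1 h2 h2
      · exact max_le_max_right 0 (hanti (by simpa using hij))
      · omega
      · exact le_max_right _ _
      · exact le_rfl
    · intro k
      simp only [a]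
      split_ifs
      exacts [le_max_right _ _, le_rfl]
    · intro k hk
      have h1 := hx (Finset.univ.map ((Fin.castLEEmb hk).trans σ.toEmbedding))
      rw [Finset.sum_map, Finset.card_map, Finset.card_univ, Fintype.card_fin] at h1
      have h2 : ∑ i : Fin k, x (((Fin.castLEEmb hk).trans σ.toEmbedding) i) =
          ∑ i ∈ Finset.range k, X i := by
        rw [← Fin.sum_univ_eq_sum_range]
        refine Finset.sum_congr rfl fun i _ => ?_
        have : (i : ℕ) < m := i.isLt.trans_le hk
        simp only [X, this, dif_pos]
        rfl
      have h3 : ∑ i ∈ Finset.range k, ((i : ℕ) : ℝ) = (k.choose 2 : ℕ) := by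
        rw [Nat.choose_two_right, ← Finset.sum_range_id, Nat.cast_sum]
      rw [h2] at h1
      rw [Finset.sum_sub_distrib, ← Finset.mul_sum, Finset.sum_sub_distrib, h3,
        Finset.sum_const, Finset.card_range, nsmul_eq_mul]
      linarith

theorem mem_smul_partialPermutohedron_iff {m n : ℕ} (hn : m ≤ n + 1) (t : ℕ) (x : Fin m → ℝ) :
    x ∈ (t : ℝ) • partialPermutohedron m n ↔
      (∀ i, 0 ≤ x i) ∧
        ∀ S : Finset (Fin m), ∑ i ∈ S, x i ≤ t * (n * S.card - S.card.choose 2) := by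
  constructor
  · rw [partialPermutohedron, ← convexHull_smul]
    intro hx
    have hconv : Convex ℝ {x : Fin m → ℝ | (∀ i, 0 ≤ x i) ∧
        ∀ S : Finset (Fin m), ∑ i ∈ S, x i ≤ t * (n * S.card - S.card.choose 2)} := by
      rintro x ⟨hx0, hx⟩ y ⟨hy0, hy⟩ a b ha hb hab
      refine ⟨fun i => add_nonneg (mul_nonneg ha (hx0 i)) (mul_nonneg hb (hy0 i)), fun S => ?_⟩
      simp only [Pi.add_apply, Pi.smul_apply, smul_eq_mul, Finset.sum_add_distrib,
        ← Finset.mul_sum]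
      calc _ ≤ a * (t * (n * S.card - S.card.choose 2)) +
            b * (t * (n * S.card - S.card.choose 2)) :=
            add_le_add (mul_le_mul_of_nonneg_left (hx S) ha) (mul_le_mul_of_nonneg_left (hy S) hb)
        _ = _ := by rw [← add_mul, hab, one_mul]
    refine convexHull_min ?_ hconv hx
    rintro _ ⟨_, ⟨y, hy, hinj, rfl⟩, rfl⟩
    refine ⟨fun i => by simp only [Pi.smul_apply, smul_eq_mul]; positivity, fun S => ?_⟩
    have hS : S.card ≤ n + 1 := (card_finset_fin_le S).trans hn
    have h := sum_le_of_injective_ne_zero hy hinj S hS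
    have h' : (∑ i ∈ S, (y i : ℝ)) + (S.card.choose 2 : ℕ) ≤ n * S.card := by exact_mod_cast h
    simp only [Pi.smul_apply, smul_eq_mul, ← Finset.mul_sum]
    exact mul_le_mul_of_nonneg_left (by linarith) t.cast_nonneg
  · rintro ⟨hx0, hx⟩
    by_contra hcon
    have hfin : {x : Fin m → ℝ | ∃ y : Fin m → ℕ, (∀ i, y i ≤ n) ∧
        (∀ i j, i ≠ j → y i ≠ 0 → y j ≠ 0 → y i ≠ y j) ∧
        x = fun i => (y i : ℝ)}.Finite := by
      refine ((Set.finite_Iic (fun _ : Fin m => n)).image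
        fun y : Fin m → ℕ => fun i => (y i : ℝ)).subset ?_
      rintro _ ⟨y, hy, -, rfl⟩
      exact ⟨y, fun i => hy i, rfl⟩
    rw [partialPermutohedron, ← convexHull_smul] at hcon
    obtain ⟨f, u, hf, hfx⟩ := geometric_hahn_banach_closed_point (convex_convexHull ℝ _)
      ((hfin.smul_set (a := (t : ℝ))).isClosed_convexHull ℝ) hcon
    have hsum : ∀ z : Fin m → ℝ,
        f z = ∑ i, z i * f fun j => if i = j then 1 else 0 := fun z => by
      simpa using LinearMap.pi_apply_eq_sum_univ (f : (Fin m → ℝ) →ₗ[ℝ] ℝ) z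
    obtain ⟨y, hy, hinj, hle⟩ := exists_vertex_sum_le hn t hx0 hx
      fun i => f fun j => if i = j then 1 else 0
    have h1 := hf ((t : ℝ) • fun i => (y i : ℝ))
      (subset_convexHull ℝ _ (Set.smul_mem_smul_set ⟨y, hy, hinj, rfl⟩))
    rw [hsum] at h1 hfx
    simp only [Pi.smul_apply, smul_eq_mul] at h1
    linarith

end Polytope

theorem card_lattice_points_eq {m n : ℕ} (hn : m ≤ n + 1) (t : ℕ) :
    Nat.card {x : Fin m → ℤ |
        (fun i => (x i : ℝ)) ∈ (t : ℝ) • partialPermutohedron m n} =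
      (feasible t (t * n + 1) (Finset.univ : Finset (Fin m))).card := by
  rw [← Nat.card_eq_finsetCard]
  refine Nat.card_congr ((Equiv.subLeft fun _ : Fin m => (t * n : ℤ)).subtypeEquiv fun x => ?_)
  rw [Set.mem_ofPred_eq, mem_smul_partialPermutohedron_iff hn, feasible, Finset.mem_filter,
    excess_le_iff, box, Fintype.mem_piFinset]
  have key : ∀ S : Finset (Fin m),
      (∑ i ∈ S, (x i : ℝ) ≤ t * (n * S.card - S.card.choose 2)) ↔
      ((t : ℤ) * (S.card.choose 2 : ℕ) + ∑ i ∈ S, ((0 : Fin m → ℤ) i -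
        (Equiv.subLeft fun _ : Fin m => (t * n : ℤ)) x i) ≤ 0) := by
    intro S
    have h : (∑ i ∈ S, (x i : ℝ) ≤ t * (n * S.card - S.card.choose 2)) ↔
        (∑ i ∈ S, x i ≤ t * (n * S.card - S.card.choose 2)) := by
      rw [← Int.cast_le (R := ℝ)]
      push_cast
      rfl
    rw [h]
    simp only [Equiv.subLeft_apply, Pi.zero_apply, Pi.sub_apply, zero_sub, neg_sub,
      Finset.sum_sub_distrib, Finset.sum_const, nsmul_eq_mul]
    constructor <;> intro h <;> linarith
  simp only [key, Finset.mem_univ, if_true, Finset.mem_Ico, Equiv.subLeft_apply, Pi.sub_apply,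
    Finset.subset_univ, forall_const, Int.cast_nonneg_iff]
  refine ⟨fun ⟨h0, h⟩ => ⟨fun i => ⟨?_, ?_⟩, h⟩, fun ⟨h0, h⟩ => ⟨fun i => ?_, h⟩⟩
  · simpa using h {i}
  · have := h0 i
    push_cast
    linarith
  · have := (h0 i).2
    push_cast at this
    linarith

/-- main theorem: for positive integers `m, n` with `n ≥ m-1`, the
Ehrhart polynomial of `P(m,n)` is
`(1/2^m) ∑_{i=0}^{⌊m/2⌋} ∑_{j=2i}^m (-1)^{i+1} (m!/((m-j)!(j-2i)!(i!)²)) i! (2j-4i-3)!!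
t^{j-i} (2nt+t+2)^{m-j}`,
where `(2j-4i-3)!! = -∏_{k=1}^{j-2i}(2k-3)`; here this is stated as an identity for the
number of lattice points in the dilate `t·P(m,n)` for every nonnegative integer `t`. -/
theorem ehrhart_partialPermutohedron (m n : ℕ) (hm : 1 ≤ m) (hn : m ≤ n + 1) (t : ℕ) :
    (Nat.card {x : Fin m → ℤ |
        (fun i => (x i : ℝ)) ∈ (t : ℝ) • partialPermutohedron m n} : ℚ) =
      (1 / 2 ^ m) * ∑ i ∈ Finset.range (m / 2 + 1), ∑ j ∈ Finset.Icc (2 * i) m,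
        (-1) ^ (i + 1) *
          ((m.factorial : ℚ) /
            ((m - j).factorial * (j - 2 * i).factorial * i.factorial ^ 2)) *
          i.factorial *
          (-(∏ k ∈ Finset.range (j - 2 * i), (2 * (k : ℚ) - 1))) *
          (t : ℚ) ^ (j - i) * (2 * n * t + t + 2) ^ (m - j) := by
  obtain ⟨k, rfl⟩ : ∃ k, m = k + 1 := ⟨m - 1, by omega⟩
  rw [card_lattice_points_eq hn t]
  have hb : t * k ≤ t * n + 1 := (Nat.mul_le_mul_left t (by omega)).trans (Nat.le_succ _)
  rw [(feasible_totalExcess_eq (ehrhartValue_zero t (t * n + 1 : ℕ))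
      (ehrhartValue_one t (t * n + 1 : ℕ)) (fun _ => rfl)
      (ehrhartValue_add_two t (t * n + 1 : ℕ)) k).1 Finset.univ (Finset.card_fin _) hb,
    ehrhartValue_eq_sum,
    show 2 * ((t * n + 1 : ℕ) : ℚ) + t = 2 * n * t + t + 2 by push_cast; ring]
end

section
/- For positive integers m and n with n ≥ m-1, the volume of P(m,n) equals -(1/2^m) sum_{i=0}^{m} binom(m,i)·(2i-3)!!·(2n+1)^{m-i}, where (2i-3)!! = -prod_{k=1}^{i}(2k-3). -/
open Pointwise

open Finset in
/-- Exchange of the order of summation over the compositions of `m` into four parts. -/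
theorem sum_antidiagonal_antidiagonal_swap {M : Type*} [AddCommMonoid M] (m : ℕ)
    (F : ℕ → ℕ → ℕ → ℕ → M) :
    ∑ a ∈ antidiagonal m, ∑ b ∈ antidiagonal a.1, ∑ c ∈ antidiagonal a.2, F b.1 b.2 c.1 c.2 =
      ∑ a ∈ antidiagonal m, ∑ b ∈ antidiagonal a.1, ∑ c ∈ antidiagonal a.2,
        F b.1 c.1 b.2 c.2 := by
  simp only [Finset.sum_sigma']
  refine Finset.sum_nbij'
    (fun x => ⟨(x.2.1.1 + x.2.2.1, x.2.1.2 + x.2.2.2),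
      ⟨(x.2.1.1, x.2.2.1), (x.2.1.2, x.2.2.2)⟩⟩)
    (fun x => ⟨(x.2.1.1 + x.2.2.1, x.2.1.2 + x.2.2.2),
      ⟨(x.2.1.1, x.2.2.1), (x.2.1.2, x.2.2.2)⟩⟩)
    ?_ ?_ ?_ ?_ ?_ <;>
  rintro ⟨⟨a, b⟩, ⟨c, d⟩, ⟨e, f⟩⟩ h <;>
  simp only [mem_sigma, HasAntidiagonal.mem_antidiagonal] at h ⊢
  · simp only [and_true]; omega
  · simp only [and_true]; omega
  · obtain ⟨h1, rfl, rfl⟩ := h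
    rfl
  · obtain ⟨h1, rfl, rfl⟩ := h
    rfl

open Finset in
theorem sum_antidiagonal_antidiagonal_assoc {M : Type*} [AddCommMonoid M] (m : ℕ)
    (F : ℕ → ℕ → ℕ → M) :
    ∑ a ∈ antidiagonal m, ∑ b ∈ antidiagonal a.2, F a.1 b.1 b.2 =
      ∑ a ∈ antidiagonal m, ∑ b ∈ antidiagonal a.1, F b.1 b.2 a.2 := by
  simp only [Finset.sum_sigma']
  refine Finset.sum_nbij'
    (fun x => ⟨(x.1.1 + x.2.1, x.2.2), (x.1.1, x.2.1)⟩)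
    (fun x => ⟨(x.2.1, x.2.2 + x.1.2), (x.2.2, x.1.2)⟩)
    ?_ ?_ ?_ ?_ ?_ <;>
  rintro ⟨⟨a, b⟩, ⟨c, d⟩⟩ h <;>
  simp only [mem_sigma, HasAntidiagonal.mem_antidiagonal] at h ⊢
  · simp only [and_true]; omega
  · simp only [and_true]; omega
  · obtain ⟨h1, rfl⟩ := h
    rfl
  · obtain ⟨h1, rfl⟩ := h
    rfl

/-- The coefficients of the power series `√(1 - X)`. -/
noncomputable def sqrtCoeff (i : ℕ) : ℝ :=
  (∏ k ∈ Finset.range i, ((k : ℝ) - 1 / 2)) / (i.factorial : ℝ)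

theorem sqrtCoeff_succ (i : ℕ) :
    ((i : ℝ) + 1) * sqrtCoeff (i + 1) = ((i : ℝ) - 1 / 2) * sqrtCoeff i := by
  have h : (i.factorial : ℝ) ≠ 0 := by positivity
  have h' : (i : ℝ) + 1 ≠ 0 := by positivity
  unfold sqrtCoeff
  rw [Finset.prod_range_succ, Nat.factorial_succ]
  push_cast
  field_simp
  ring_nf

open PowerSeries in
theorem mk_sqrtCoeff_mul_self :
    (PowerSeries.mk sqrtCoeff) * (PowerSeries.mk sqrtCoeff) = 1 - (X : PowerSeries ℝ) := by
  set S := PowerSeries.mk sqrtCoeff with hS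
  have hd : (1 - X) * d⁄dX ℝ S = C (-1 / 2 : ℝ) * S := by
    ext n
    rw [sub_mul, one_mul, map_sub, coeff_C_mul, coeff_derivative, hS, coeff_mk, coeff_mk]
    cases n with
    | zero =>
      have := sqrtCoeff_succ 0
      simp at this ⊢
      linarith
    | succ k =>
      rw [coeff_succ_X_mul, coeff_derivative, coeff_mk]
      have := sqrtCoeff_succ (k + 1)
      push_cast at this ⊢
      linarith
  have hd2 : (1 - X) * d⁄dX ℝ (S * S) = - (S * S) := by
    have hC : (C (-1 / 2 : ℝ)) + C (-1 / 2 : ℝ) = (-1 : PowerSeries ℝ) := by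
      rw [← map_add]; norm_num
    rw [Derivation.leibniz, smul_eq_mul]
    linear_combination (2 * S) * hd + S * S * hC
  have hrec : ∀ n : ℕ, ((n : ℝ) + 1) * coeff (n + 1) (S * S) = ((n : ℝ) - 1) * coeff n (S * S) := by
    intro n
    have h := congrArg (coeff n) hd2
    rw [sub_mul, one_mul, map_sub, map_neg, coeff_derivative] at h
    cases n with
    | zero => simp at h ⊢; linarith
    | succ k =>
      rw [coeff_succ_X_mul, coeff_derivative] at h
      push_cast at h ⊢
      linarith
  have h0 : coeff 0 (S * S) = 1 := by
    simp [hS, sqrtCoeff]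
  have h1 : coeff 1 (S * S) = -1 := by
    have := hrec 0
    rw [h0] at this
    simpa using this
  have h2 : ∀ n, coeff (n + 2) (S * S) = 0 := by
    intro n
    induction n with
    | zero => have := hrec 1; norm_num at this; exact this
    | succ k ih =>
      have := hrec (k + 2)
      rw [ih, mul_zero] at this
      exact (mul_eq_zero.mp this).resolve_left (by positivity)
  ext n
  match n with
  | 0 => rw [h0]; simp
  | 1 => rw [h1]; simp [coeff_one]
  | n + 2 => rw [h2]; simp [coeff_one, coeff_X]

open Finset in
theorem sum_choose_mul_neg_one_pow_mul_pow (r : ℕ) (y : ℝ) :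
    ∑ k ∈ range (r + 1), (r.choose k : ℝ) * (-1) ^ (r - k) * (y + k) ^ r = r.factorial := by
  have h := fwdDiff_iter_eq_sum_shift (1 : ℝ) (fun x : ℝ => x ^ r) r y
  rw [fwdDiff_iter_eq_factorial] at h
  simp only [Pi.natCast_apply] at h
  rw [h]
  refine Finset.sum_congr rfl fun k _ => ?_
  rw [zsmul_eq_mul]
  push_cast
  rw [nsmul_eq_mul, mul_one]
  ring

open Finset in
/-- An identity of Abel–Cauchy type. -/
theorem sum_antidiagonal_add_pow_mul_sub_pow (r : ℕ) (y t : ℝ) :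
    ∑ p ∈ antidiagonal r, (y + p.1) ^ p.1 / p.1.factorial *
        ((t - y - p.1) ^ p.2 / p.2.factorial) =
      ∑ q ∈ range (r + 1), t ^ q / q.factorial := by
  have key : ∀ p ∈ antidiagonal r, (y + p.1) ^ p.1 / p.1.factorial *
        ((t - y - p.1) ^ p.2 / p.2.factorial) = ∑ b ∈ antidiagonal p.2,
        (y + p.1) ^ p.1 / p.1.factorial * ((-(y + p.1)) ^ b.1 / b.1.factorial) *
          (t ^ b.2 / b.2.factorial) := by
    intro p _
    have : t - y - p.1 = -(y + p.1) + t := by ring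
    rw [this, (Commute.all (-(y + p.1)) t).add_pow', Finset.sum_div, Finset.mul_sum]
    refine Finset.sum_congr rfl fun b hb => ?_
    rw [HasAntidiagonal.mem_antidiagonal] at hb
    rw [← hb, nsmul_eq_mul, Nat.cast_add_choose]
    field_simp
  have inner : ∀ e : ℕ, ∑ b ∈ antidiagonal e,
      (y + b.1) ^ b.1 / b.1.factorial * ((-(y + b.1)) ^ b.2 / b.2.factorial) = 1 := by
    intro e
    have he : (e.factorial : ℝ) ≠ 0 := by positivity
    rw [← (div_eq_one_iff_eq he).mpr (sum_choose_mul_neg_one_pow_mul_pow e y), Finset.sum_div,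
      ← Finset.Nat.sum_antidiagonal_eq_sum_range_succ
        (fun i j => (e.choose i : ℝ) * (-1) ^ j * (y + i) ^ e / e.factorial)]
    refine Finset.sum_congr rfl fun b hb => ?_
    rw [HasAntidiagonal.mem_antidiagonal] at hb
    rw [← hb, Nat.cast_add_choose, neg_pow, pow_add]
    field_simp
  rw [Finset.sum_congr rfl key, sum_antidiagonal_antidiagonal_assoc r (fun i j l =>
      (y + i) ^ i / i.factorial * ((-(y + i)) ^ j / j.factorial) * (t ^ l / l.factorial)),
    ← Finset.Nat.sum_antidiagonal_eq_sum_range_succ_mk (fun p : ℕ × ℕ => t ^ p.1 / p.1.factorial),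
    ← Finset.Nat.sum_antidiagonal_swap]
  refine Finset.sum_congr rfl fun p _ => ?_
  rw [← Finset.sum_mul]
  simp only [Prod.fst_swap, Prod.snd_swap]
  rw [inner, one_mul]

open Finset in
/-- The expected volume of the `m`-dimensional polytope with parameter `t`, divided by `m!`. -/
noncomputable def normalizedVolume (m : ℕ) (t : ℝ) : ℝ :=
  ∑ p ∈ antidiagonal m, sqrtCoeff p.1 * ((t + 1 / 2) ^ p.2 / p.2.factorial)

open Finset PowerSeries in
theorem sum_normalizedVolume_mul_normalizedVolume (m : ℕ) (t : ℝ) :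
    ∑ p ∈ antidiagonal m, normalizedVolume p.1 (p.1 - 1) * normalizedVolume p.2 (t - p.1) =
      t ^ m / m.factorial := by
  set S := PowerSeries.mk sqrtCoeff with hS
  set G := PowerSeries.mk (fun r : ℕ => ∑ q ∈ range (r + 1), t ^ q / (q.factorial : ℝ)) with hG
  have hcoeff : coeff m (S * S * G) = t ^ m / m.factorial := by
    rw [mk_sqrtCoeff_mul_self, sub_mul, one_mul, map_sub]
    cases m with
    | zero => simp [hG]
    | succ k =>
      rw [coeff_succ_X_mul, hG, coeff_mk, coeff_mk, sum_range_succ _ (k + 1)]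
      ring
  have h1 : ∑ p ∈ antidiagonal m, normalizedVolume p.1 (p.1 - 1) * normalizedVolume p.2 (t - p.1) =
      ∑ a ∈ antidiagonal m, ∑ b ∈ antidiagonal a.1, ∑ c ∈ antidiagonal a.2,
        sqrtCoeff b.1 * sqrtCoeff c.1 *
          (((b.1 - 1 / 2 + b.2 : ℝ)) ^ b.2 / b.2.factorial *
            ((t - (b.1 - 1 / 2) - b.2) ^ c.2 / c.2.factorial)) := by
    refine Finset.sum_congr rfl fun p _ => ?_
    rw [normalizedVolume, normalizedVolume, Finset.sum_mul_sum]
    refine Finset.sum_congr rfl fun b hb => Finset.sum_congr rfl fun c _ => ?_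
    rw [HasAntidiagonal.mem_antidiagonal] at hb
    rw [← hb]
    push_cast
    rw [show (b.1 : ℝ) + b.2 - 1 + 1 / 2 = b.1 - 1 / 2 + b.2 by ring,
      show t - ((b.1 : ℝ) + b.2) + 1 / 2 = t - (b.1 - 1 / 2) - b.2 by ring]
    ring
  rw [h1, sum_antidiagonal_antidiagonal_swap m (fun i l j p => sqrtCoeff i * sqrtCoeff j *
          (((i - 1 / 2 + l : ℝ)) ^ l / l.factorial *
            ((t - (i - 1 / 2) - l) ^ p / p.factorial))), ← hcoeff, coeff_mul]
  refine Finset.sum_congr rfl fun a _ => ?_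
  rw [coeff_mul, Finset.sum_mul]
  refine Finset.sum_congr rfl fun b _ => ?_
  rw [← Finset.mul_sum, sum_antidiagonal_add_pow_mul_sub_pow a.2, hS, hG, coeff_mk, coeff_mk,
    coeff_mk]

/-- The sum `t + (t - 1) + ⋯ + (t - k + 1)`. -/
noncomputable def rankBound (t : ℝ) (k : ℕ) : ℝ := k * t - k * (k - 1) / 2

/-- The polymatroid of the rank function `S ↦ rankBound t #S`. -/
def polymatroid (ι : Type*) (t : ℝ) : Set (ι → ℝ) :=
  {x | (∀ i, 0 ≤ x i) ∧ ∀ T : Finset ι, ∑ i ∈ T, x i ≤ rankBound t T.card}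

theorem isClosed_polymatroid (ι : Type*) (t : ℝ) : IsClosed (polymatroid ι t) := by
  have : polymatroid ι t = (⋂ i, {x | 0 ≤ x i}) ∩
      ⋂ T : Finset ι, {x | ∑ i ∈ T, x i ≤ rankBound t T.card} := by
    ext x; simp [polymatroid]
  rw [this]
  refine (isClosed_iInter fun i => ?_).inter (isClosed_iInter fun T => ?_)
  · exact isClosed_le continuous_const (by fun_prop)
  · exact isClosed_le (by fun_prop) continuous_const

theorem convex_polymatroid (ι : Type*) (t : ℝ) : Convex ℝ (polymatroid ι t) := by
  intro x hx y hy a b ha hb hab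
  refine ⟨fun i => ?_, fun T => ?_⟩
  · exact add_nonneg (mul_nonneg ha (hx.1 i)) (mul_nonneg hb (hy.1 i))
  · calc ∑ i ∈ T, (a • x + b • y) i = a * ∑ i ∈ T, x i + b * ∑ i ∈ T, y i := by
          simp [Finset.sum_add_distrib, Finset.mul_sum]
      _ ≤ a * rankBound t T.card + b * rankBound t T.card :=
          add_le_add (mul_le_mul_of_nonneg_left (hx.2 T) ha) (mul_le_mul_of_nonneg_left (hy.2 T) hb)
      _ = rankBound t T.card := by rw [← add_mul, hab, one_mul]

theorem restrict_mem_polymatroid_iff {ι : Type*} (p : ι → Prop) (t : ℝ) (x : ι → ℝ) :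
    (fun i : {i // p i} => x i) ∈ polymatroid {i // p i} t ↔
      (∀ i, p i → 0 ≤ x i) ∧
        ∀ T : Finset ι, (∀ i ∈ T, p i) → ∑ i ∈ T, x i ≤ rankBound t T.card := by
  classical
  refine ⟨fun h => ⟨fun i hi => h.1 ⟨i, hi⟩, fun T hT => ?_⟩,
    fun h => ⟨fun i => h.1 i i.2, fun T => ?_⟩⟩
  · have := h.2 (T.subtype p)
    rwa [Finset.sum_subtype_of_mem x hT, Finset.card_subtype, Finset.filter_true_of_mem hT] at this
  · have := h.2 (T.map (Function.Embedding.subtype p)) (by simp +contextual)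
    simpa using this

open MeasureTheory

theorem volume_polymatroid_congr {ι κ : Type*} [Fintype ι] [Fintype κ] (e : ι ≃ κ) (t : ℝ) :
    volume (polymatroid ι t) = volume (polymatroid κ t) := by
  have h := (volume_measurePreserving_piCongrLeft (fun _ : κ => ℝ) e).measure_preimage_equiv
    (polymatroid κ t)
  rw [← h]
  congr 1
  ext x
  have hx : ∀ i, (MeasurableEquiv.piCongrLeft (fun _ : κ => ℝ) e) x (e i) = x i := fun i =>
    MeasurableEquiv.piCongrLeft_apply_apply (β := fun _ : κ => ℝ) e x i
  constructor
  · intro h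
    refine ⟨fun k => ?_, fun T => ?_⟩
    · obtain ⟨i, rfl⟩ := e.surjective k
      rw [hx]
      exact h.1 i
    · have := h.2 (T.map e.symm.toEmbedding)
      rw [Finset.sum_map, Finset.card_map] at this
      convert this using 2 with k
      obtain ⟨i, rfl⟩ := e.surjective k
      rw [hx]
      simp
  · intro h
    refine ⟨fun i => ?_, fun T => ?_⟩
    · have := h.1 (e i)
      rwa [hx] at this
    · have := h.2 (T.map e.toEmbedding)
      rw [Finset.sum_map, Finset.card_map] at this
      convert this using 2 with i
      exact (hx i).symm

/-- The part of the cube `[0, t]^ι` on which `S` is the most violated constraint of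
`polymatroid ι t`. -/
def violationCell {ι : Type*} (t : ℝ) (S : Finset ι) : Set (ι → ℝ) :=
  {x | (∀ i, 0 ≤ x i ∧ x i ≤ t) ∧ ∀ T : Finset ι,
    ∑ i ∈ T, x i - rankBound t T.card ≤ ∑ i ∈ S, x i - rankBound t S.card}

theorem isClosed_violationCell {ι : Type*} (t : ℝ) (S : Finset ι) :
    IsClosed (violationCell t S) := by
  have : violationCell t S = (⋂ i, {x | 0 ≤ x i} ∩ {x | x i ≤ t}) ∩ ⋂ T : Finset ι,
      {x | ∑ i ∈ T, x i - rankBound t T.card ≤ ∑ i ∈ S, x i - rankBound t S.card} := by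
    ext x; simp [violationCell]
  rw [this]
  refine (isClosed_iInter fun i => ?_).inter (isClosed_iInter fun T => ?_)
  · exact (isClosed_le continuous_const (by fun_prop)).inter
      (isClosed_le (by fun_prop) continuous_const)
  · exact isClosed_le (by fun_prop) (by fun_prop)

theorem mem_violationCell_iff {ι : Type*} [Fintype ι] {t : ℝ}
    (ht : (Fintype.card ι : ℝ) ≤ t + 1) (S : Finset ι) (x : ι → ℝ) :
    x ∈ violationCell t S ↔
      (fun i : {i // i ∈ S} => t - x i) ∈ polymatroid {i // i ∈ S} (S.card - 1) ∧
      (fun i : {i // i ∉ S} => x i) ∈ polymatroid {i // i ∉ S} (t - S.card) := by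
  classical
  have hS : (S.card : ℝ) ≤ t + 1 := le_trans (by exact_mod_cast S.card_le_univ) ht
  rw [restrict_mem_polymatroid_iff (· ∈ S) (S.card - 1) (fun i => t - x i),
    restrict_mem_polymatroid_iff (· ∉ S)]
  constructor
  · rintro ⟨hx, hmax⟩
    refine ⟨⟨fun i _ => sub_nonneg.2 (hx i).2, fun T hT => ?_⟩, fun i _ => (hx i).1, fun T hT => ?_⟩
    · have hTS : T ⊆ S := hT
      have h1 := hmax (S \ T)
      have h2 := Finset.sum_sdiff (f := x) hTS
      have h3 : ((S \ T).card : ℝ) = S.card - T.card := by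
        rw [Finset.card_sdiff_of_subset hTS, Nat.cast_sub (Finset.card_le_card hTS)]
      rw [Finset.sum_sub_distrib, Finset.sum_const, nsmul_eq_mul]
      unfold rankBound at *
      rw [h3] at h1
      linarith
    · have hTS : Disjoint S T := Finset.disjoint_right.2 hT
      have h1 := hmax (S ∪ T)
      rw [Finset.sum_union hTS, Finset.card_union_of_disjoint hTS] at h1
      unfold rankBound at *
      push_cast at h1
      linarith
  · rintro ⟨⟨hA0, hA⟩, hB0, hB⟩
    refine ⟨fun i => ?_, fun T => ?_⟩
    · by_cases hi : i ∈ S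
      · have h1 := hA {i} (by simpa using hi)
        have h2 := hA0 i hi
        simp only [rankBound, Finset.sum_singleton, Finset.card_singleton] at h1
        push_cast at h1
        constructor <;> linarith
      · have h1 := hB {i} (by simpa using hi)
        have h2 := hB0 i hi
        have h3 : (0 : ℝ) ≤ S.card := by positivity
        simp only [rankBound, Finset.sum_singleton, Finset.card_singleton] at h1
        push_cast at h1
        constructor <;> linarith
    · have h1 := hA (S \ T) (fun i hi => (Finset.mem_sdiff.1 hi).1)
      have h2 := hB (T \ S) (fun i hi => (Finset.mem_sdiff.1 hi).2)
      have h3 := Finset.sum_inter_add_sum_sdiff S T x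
      have h4 := Finset.sum_inter_add_sum_sdiff T S x
      have h5 : (S.card : ℝ) = (S ∩ T).card + (S \ T).card := by
        exact_mod_cast (Finset.card_inter_add_card_sdiff S T).symm
      have h6 : (T.card : ℝ) = (S ∩ T).card + (T \ S).card := by
        rw [Finset.inter_comm]
        exact_mod_cast (Finset.card_inter_add_card_sdiff T S).symm
      have h7 : (0 : ℝ) ≤ (T \ S).card * (S \ T).card := by positivity
      rw [Finset.inter_comm T S] at h4
      rw [Finset.sum_sub_distrib, Finset.sum_const, nsmul_eq_mul] at h1
      unfold rankBound at *
      rw [h5] at h1 h2 ⊢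
      rw [h6]
      nlinarith

theorem volume_hyperplane_eq_zero {ι : Type*} [Fintype ι] (L : (ι → ℝ) →ₗ[ℝ] ℝ) (hL : L ≠ 0)
    (c : ℝ) : volume {x | L x = c} = 0 := by
  rcases Set.eq_empty_or_nonempty {x | L x = c} with h | ⟨x₀, hx₀⟩
  · rw [h, measure_empty]
  · have hs : {x | L x = c} = (AffineSubspace.mk' x₀ (LinearMap.ker L) : Set (ι → ℝ)) := by
      ext x
      simp only [Set.mem_ofPred_eq] at hx₀
      simp [AffineSubspace.mem_mk', sub_eq_zero, hx₀]
    rw [hs]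
    refine Measure.addHaar_affineSubspace _ _ fun htop => hL ?_
    have := congrArg AffineSubspace.direction htop
    rwa [AffineSubspace.direction_mk', AffineSubspace.direction_top, LinearMap.ker_eq_top] at this

theorem aedisjoint_violationCell {ι : Type*} [Fintype ι] (t : ℝ) {S T : Finset ι} (h : S ≠ T) :
    AEDisjoint volume (violationCell t S) (violationCell t T) := by
  classical
  let L : (ι → ℝ) →ₗ[ℝ] ℝ :=
    (∑ i ∈ S, LinearMap.proj i) - ∑ i ∈ T, LinearMap.proj i
  have hLx : ∀ x, L x = ∑ i ∈ S, x i - ∑ i ∈ T, x i := fun x => by simp [L]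
  have hL : L ≠ 0 := by
    intro h0
    apply h
    ext i
    have := hLx (Pi.single i 1)
    rw [h0] at this
    by_cases h1 : i ∈ S <;> by_cases h2 : i ∈ T <;> simp_all
  refine measure_mono_null (fun x hx => ?_)
    (volume_hyperplane_eq_zero L hL (rankBound t S.card - rankBound t T.card))
  have h1 := hx.1.2 T
  have h2 := hx.2.2 S
  rw [Set.mem_ofPred_eq, hLx]
  linarith

/-- The volume of the polymatroid in dimension `k`. -/
noncomputable def polymatroidVolume (k : ℕ) (t : ℝ) : ℝ :=
  volume.real (polymatroid (Fin k) t)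

theorem volume_real_polymatroid (ι : Type*) [Fintype ι] (t : ℝ) :
    volume.real (polymatroid ι t) = polymatroidVolume (Fintype.card ι) t := by
  rw [polymatroidVolume, measureReal_def, measureReal_def,
    volume_polymatroid_congr (Fintype.equivFin ι)]

theorem volume_real_violationCell {ι : Type*} [Fintype ι] {t : ℝ}
    (ht : (Fintype.card ι : ℝ) ≤ t + 1) (S : Finset ι) :
    volume.real (violationCell t S) = polymatroidVolume S.card (S.card - 1) *
      polymatroidVolume (Fintype.card ι - S.card) (t - S.card) := by
  classical
  let A : Set ({i // i ∈ S} → ℝ) :=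
    (fun y => (fun _ => t) - y) ⁻¹' polymatroid {i // i ∈ S} (S.card - 1)
  let B : Set ({i // i ∉ S} → ℝ) := polymatroid {i // i ∉ S} (t - S.card)
  have hpre : violationCell t S =
      MeasurableEquiv.piEquivPiSubtypeProd (fun _ : ι => ℝ) (· ∈ S) ⁻¹' (A ×ˢ B) := by
    ext x
    rw [mem_violationCell_iff ht]
    rfl
  have hA : ∀ _ : Fintype {i // i ∈ S},
      volume A = volume (polymatroid {i // i ∈ S} (S.card - 1)) := fun _ =>
    (Measure.measurePreserving_sub_left volume _).measure_preimage
      (isClosed_polymatroid _ _).nullMeasurableSet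
  rw [measureReal_def, hpre,
    (volume_preserving_piEquivPiSubtypeProd (fun _ : ι => ℝ) (· ∈ S)).measure_preimage_equiv,
    Measure.volume_eq_prod, Measure.prod_prod, hA, ENNReal.toReal_mul, ← measureReal_def,
    ← measureReal_def, volume_real_polymatroid, volume_real_polymatroid]
  simp [Fintype.card_subtype_compl]

open Finset in
theorem sum_choose_mul_polymatroidVolume (m : ℕ) {t : ℝ} (h0 : 0 ≤ t) (ht : (m : ℝ) ≤ t + 1) :
    ∑ k ∈ range (m + 1), (m.choose k : ℝ) *
      (polymatroidVolume k (k - 1) * polymatroidVolume (m - k) (t - k)) = t ^ m := by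
  have hcover : Set.Icc (0 : Fin m → ℝ) (fun _ => t) =
      ⋃ S ∈ (univ : Finset (Fin m)).powerset, violationCell t S := by
    ext x
    simp only [Set.mem_iUnion]
    constructor
    · intro hx
      obtain ⟨S, hS, hmax⟩ := Finset.exists_max_image (univ : Finset (Fin m)).powerset
        (fun T => ∑ i ∈ T, x i - rankBound t T.card) ⟨∅, by simp⟩
      exact ⟨S, hS, fun i => ⟨hx.1 i, hx.2 i⟩, fun T => hmax T (by simp)⟩
    · rintro ⟨S, -, hx⟩
      exact ⟨fun i => (hx.1 i).1, fun i => (hx.1 i).2⟩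
  have hfin : volume (Set.Icc (0 : Fin m → ℝ) (fun _ => t)) ≠ ⊤ := isCompact_Icc.measure_lt_top.ne
  have hcube : volume.real (Set.Icc (0 : Fin m → ℝ) (fun _ => t)) = t ^ m := by
    rw [measureReal_def, Real.volume_Icc_pi_toReal (a := 0) (fun _ => h0)]
    simp
  rw [← hcube, hcover, measureReal_biUnion_finset₀ ?_ ?_ ?_]
  · have hcard : (Fintype.card (Fin m) : ℝ) ≤ t + 1 := by simpa using ht
    rw [Finset.sum_congr rfl fun S _ => volume_real_violationCell hcard S,
      Finset.sum_powerset_apply_card (fun k => polymatroidVolume k (k - 1) *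
        polymatroidVolume (Fintype.card (Fin m) - k) (t - k))]
    simp
  · intro S _ T _ hST
    exact aedisjoint_violationCell t hST
  · exact fun S _ => (isClosed_violationCell t S).nullMeasurableSet
  · intro S hS
    refine ne_top_of_le_ne_top hfin (measure_mono ?_)
    rw [hcover]
    exact Set.subset_biUnion_of_mem hS
open Finset in
/-- Partial summation: a nonincreasing nonnegative weight preserves nonnegativity of sums all of
whose partial sums are nonnegative. -/
theorem sum_mul_nonneg_of_partial_sums_nonneg (a d : ℕ → ℝ) (m : ℕ)
    (ha : ∀ k, k + 1 < m → a (k + 1) ≤ a k) (h0 : ∀ k < m, 0 ≤ a k)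
    (hd : ∀ k ≤ m, 0 ≤ ∑ j ∈ range k, d j) : 0 ≤ ∑ j ∈ range m, a j * d j := by
  have key : ∀ k, k < m → a k * ∑ j ∈ range (k + 1), d j ≤ ∑ j ∈ range (k + 1), a j * d j := by
    intro k
    induction k with
    | zero => simp
    | succ k ih =>
      intro hk
      rw [sum_range_succ _ (k + 1), sum_range_succ _ (k + 1), mul_add]
      have h1 := mul_le_mul_of_nonneg_right (ha k hk) (hd (k + 1) hk.le)
      have h2 := ih (by omega)
      linarith
  cases m with
  | zero => simp
  | succ k => exact (mul_nonneg (h0 k (by omega)) (hd (k + 1) le_rfl)).trans (key k (by omega))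

theorem sum_le_rankBound (A : Finset ℕ) : ∀ t : ℝ, (∀ a ∈ A, (a : ℝ) ≤ t) →
    ∑ a ∈ A, (a : ℝ) ≤ rankBound t A.card := by
  induction A using Finset.induction_on_max with
  | empty => intro t _; simp [rankBound]
  | insert a A hA ih =>
    intro t ht
    have ha : a ∉ A := fun h => lt_irrefl _ (hA a h)
    have h1 := ih (a - 1) (fun x hx => by
      have : x + 1 ≤ a := hA x hx
      have : (x : ℝ) + 1 ≤ a := by exact_mod_cast this
      linarith)
    have h2 : (a : ℝ) ≤ t := ht a (by simp)
    have h3 : (0 : ℝ) ≤ A.card := by positivity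
    rw [Finset.sum_insert ha, Finset.card_insert_of_notMem ha]
    unfold rankBound at *
    push_cast
    nlinarith

theorem rankBound_mono {t : ℝ} {j k : ℕ} (hjk : j ≤ k) (hk : (k : ℝ) ≤ t + 1) :
    rankBound t j ≤ rankBound t k := by
  rcases hjk.eq_or_lt with rfl | hlt
  · exact le_rfl
  have h1 : (j : ℝ) + 1 ≤ k := by exact_mod_cast hlt
  unfold rankBound
  nlinarith

theorem sum_range_sub_eq_rankBound (t : ℝ) (k : ℕ) :
    ∑ j ∈ Finset.range k, (t - j) = rankBound t k := by
  induction k with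
  | zero => simp [rankBound]
  | succ k ih =>
    rw [Finset.sum_range_succ, ih]
    unfold rankBound
    push_cast
    ring

theorem partialPermutohedron_subset_polymatroid {m n : ℕ} (hn : m ≤ n + 1) :
    partialPermutohedron m n ⊆ polymatroid (Fin m) n := by
  refine convexHull_min ?_ (convex_polymatroid _ _)
  rintro _ ⟨y, hy, hinj, rfl⟩
  refine ⟨fun i => Nat.cast_nonneg _, fun T => ?_⟩
  have hinj' : Set.InjOn y (T.filter (y · ≠ 0)) := by
    intro i hi j hj hij
    by_contra hne
    exact hinj i j hne (Finset.mem_filter.1 hi).2 (Finset.mem_filter.1 hj).2 hij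
  have h1 : ∑ i ∈ T, (y i : ℝ) = ∑ i ∈ T.filter (y · ≠ 0), (y i : ℝ) := by
    refine (Finset.sum_subset (Finset.filter_subset _ _) fun i hi hi' => ?_).symm
    by_contra h
    exact hi' (Finset.mem_filter.2 ⟨hi, by simpa using h⟩)
  have h2 := sum_le_rankBound ((T.filter (y · ≠ 0)).image y) n (by
    intro a ha
    obtain ⟨i, -, rfl⟩ := Finset.mem_image.1 ha
    exact_mod_cast hy i)
  rw [Finset.sum_image hinj', Finset.card_image_of_injOn hinj'] at h2
  rw [h1]
  refine h2.trans (rankBound_mono (Finset.card_filter_le _ _) ?_)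
  have : T.card ≤ n + 1 := (card_finset_fin_le T).trans hn
  exact_mod_cast this

/-- The greedy algorithm: every linear functional is maximized over the polymatroid at a
generator of the partial permutohedron. -/
theorem exists_vertex_sum_mul_le {m n : ℕ} (hn : m ≤ n + 1) (w x : Fin m → ℝ)
    (hx : x ∈ polymatroid (Fin m) n) : ∃ y : Fin m → ℕ, (∀ i, y i ≤ n) ∧
      (∀ i j, i ≠ j → y i ≠ 0 → y j ≠ 0 → y i ≠ y j) ∧
      ∑ i, w i * x i ≤ ∑ i, w i * (y i : ℝ) := by
  set σ := Tuple.sort (fun i => -w i) with hσ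
  have hmono : ∀ i j, i ≤ j → w (σ j) ≤ w (σ i) := fun i j hij =>
    neg_le_neg_iff.1 (Tuple.monotone_sort (fun i => -w i) hij)
  refine ⟨fun i => if 0 < w i then n - (σ.symm i : ℕ) else 0, fun i => ?_, fun i j hij => ?_, ?_⟩
  · dsimp only
    split_ifs <;> omega
  · dsimp only
    intro hi hj h
    have h1 := (σ.symm i).isLt
    have h2 := (σ.symm j).isLt
    apply hij
    apply σ.symm.injective
    ext
    split_ifs at hi hj h <;> omega
  · let a : ℕ → ℝ := fun j => if h : j < m then max (w (σ ⟨j, h⟩)) 0 else 0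
    let d : ℕ → ℝ := fun j => ((n : ℝ) - j) - if h : j < m then x (σ ⟨j, h⟩) else 0
    have hsum : 0 ≤ ∑ j ∈ Finset.range m, a j * d j := by
      refine sum_mul_nonneg_of_partial_sums_nonneg a d m (fun k hk => ?_) (fun k hk => ?_)
        fun k hk => ?_
      · simp only [a, dif_pos hk, dif_pos (show k < m by omega)]
        exact max_le_max_right _ (hmono _ _ (by simp [Fin.le_def]))
      · simp only [a, dif_pos hk]
        exact le_max_right _ _
      · rw [Finset.sum_sub_distrib, sum_range_sub_eq_rankBound, sub_nonneg, Finset.sum_range]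
        have h := hx.2 (Finset.univ.map ((Fin.castLEEmb hk).trans σ.toEmbedding))
        rw [Finset.sum_map, Finset.card_map, Finset.card_univ, Fintype.card_fin] at h
        refine le_of_eq_of_le (Finset.sum_congr rfl fun j _ => ?_) h
        rw [dif_pos (show (j : ℕ) < m by omega)]
        rfl
    rw [← sub_nonneg, ← Finset.sum_sub_distrib, ← Equiv.sum_comp σ]
    refine hsum.trans ?_
    rw [Finset.sum_range]
    refine Finset.sum_le_sum fun j _ => ?_
    have hj : (j : ℕ) ≤ n := by omega
    simp only [a, d, dif_pos j.isLt, Fin.eta, Equiv.symm_apply_apply]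
    split_ifs with hw
    · rw [max_eq_left hw.le, Nat.cast_sub hj, mul_sub]
    · rw [max_eq_right (not_lt.1 hw)]
      have := mul_nonneg (neg_nonneg.2 (not_lt.1 hw)) (hx.1 (σ j))
      push_cast
      linarith

theorem polymatroid_subset_partialPermutohedron {m n : ℕ} (hn : m ≤ n + 1) :
    polymatroid (Fin m) n ⊆ partialPermutohedron m n := by
  intro x hx
  by_contra hmem
  have hfin : {x : Fin m → ℝ | ∃ y : Fin m → ℕ, (∀ i, y i ≤ n) ∧
      (∀ i j, i ≠ j → y i ≠ 0 → y j ≠ 0 → y i ≠ y j) ∧ x = fun i => (y i : ℝ)}.Finite := by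
    refine ((Set.finite_Iic (fun _ : Fin m => n)).image
      (fun (y : Fin m → ℕ) i => (y i : ℝ))).subset ?_
    rintro _ ⟨y, hy, -, rfl⟩
    exact ⟨y, hy, rfl⟩
  obtain ⟨f, u, hlt, hgt⟩ := geometric_hahn_banach_closed_point (convex_convexHull ℝ _)
    (hfin.isClosed_convexHull ℝ) hmem
  have hf : ∀ z, f z = ∑ i, f (Pi.single i 1) * z i := by
    intro z
    have := LinearMap.pi_apply_eq_sum_univ (f : (Fin m → ℝ) →ₗ[ℝ] ℝ) z
    rw [ContinuousLinearMap.coe_coe] at this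
    rw [this]
    refine Finset.sum_congr rfl fun i _ => ?_
    rw [smul_eq_mul, mul_comm]
    congr 2
    ext j
    simp [Pi.single_apply, eq_comm]
  obtain ⟨y, hy, hinj, hle⟩ := exists_vertex_sum_mul_le hn (fun i => f (Pi.single i 1)) x hx
  have h1 := hlt _ (subset_convexHull ℝ _ ⟨y, hy, hinj, rfl⟩)
  rw [hf] at h1 hgt
  linarith

theorem partialPermutohedron_eq_polymatroid {m n : ℕ} (hn : m ≤ n + 1) :
    partialPermutohedron m n = polymatroid (Fin m) n :=
  (partialPermutohedron_subset_polymatroid hn).antisymm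
    (polymatroid_subset_partialPermutohedron hn)

open Finset in
theorem sum_normalized_polymatroidVolume (m : ℕ) {t : ℝ} (h0 : 0 ≤ t) (ht : (m : ℝ) ≤ t + 1) :
    ∑ p ∈ antidiagonal m, polymatroidVolume p.1 (p.1 - 1) / p.1.factorial *
      (polymatroidVolume p.2 (t - p.1) / p.2.factorial) = t ^ m / m.factorial := by
  rw [← sum_choose_mul_polymatroidVolume m h0 ht, Finset.sum_div,
    ← Finset.Nat.sum_antidiagonal_eq_sum_range_succ (fun k l => (m.choose k : ℝ) *
      (polymatroidVolume k (k - 1) * polymatroidVolume l (t - k)) / m.factorial)]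
  refine Finset.sum_congr rfl fun p hp => ?_
  rw [HasAntidiagonal.mem_antidiagonal] at hp
  rw [← hp, Nat.cast_add_choose]
  field_simp

theorem polymatroidVolume_zero (t : ℝ) : polymatroidVolume 0 t = 1 := by
  have : polymatroid (Fin 0) t = Set.univ := by
    ext x
    simp [polymatroid, rankBound, Finset.eq_empty_of_isEmpty]
  rw [polymatroidVolume, this, measureReal_def]
  rw [volume_pi, Measure.pi_of_empty (x := default)]
  simp

open Finset in
/-- The convolution identity determines the volume of the polymatroid. -/
theorem polymatroidVolume_div_factorial (m : ℕ) : ∀ t : ℝ, 0 ≤ t → (m : ℝ) ≤ t + 1 →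
    polymatroidVolume m t / m.factorial = normalizedVolume m t := by
  have hzero : ∀ s : ℝ, polymatroidVolume 0 s / (Nat.factorial 0 : ℝ) = normalizedVolume 0 s := by
    intro s
    simp [polymatroidVolume_zero, normalizedVolume, sqrtCoeff]
  have hone : ∀ s : ℝ, normalizedVolume 0 s = 1 := by
    intro s
    simp [normalizedVolume, sqrtCoeff]
  induction m using Nat.strong_induction_on with
  | _ m ih =>
    rcases Nat.eq_zero_or_pos m with rfl | hm
    · exact fun t _ _ => hzero t
    let D : ℝ → ℝ := fun t => polymatroidVolume m t / m.factorial - normalizedVolume m t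
    have hD : ∀ t : ℝ, 0 ≤ t → (m : ℝ) ≤ t + 1 → D t + D (m - 1) = 0 := by
      intro t h0 ht
      have h := sub_eq_zero.2 ((sum_normalized_polymatroidVolume m h0 ht).trans
        (sum_normalizedVolume_mul_normalizedVolume m t).symm)
      rw [← Finset.sum_sub_distrib, Finset.sum_eq_add (0, m) (m, 0) (by simp [hm.ne])] at h
      · rw [← h]
        simp only [D, hzero, hone, Nat.cast_zero, sub_zero]
        ring
      · rintro ⟨k, l⟩ hp hne
        rw [HasAntidiagonal.mem_antidiagonal] at hp
        dsimp only at hp ⊢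
        have hk : k ≠ 0 := fun h => hne.1 (by ext <;> simp <;> omega)
        have hl : l ≠ 0 := fun h => hne.2 (by ext <;> simp <;> omega)
        have hkr : (1 : ℝ) ≤ k := by exact_mod_cast Nat.one_le_iff_ne_zero.2 hk
        have hlr : (1 : ℝ) ≤ l := by exact_mod_cast Nat.one_le_iff_ne_zero.2 hl
        have hmr : (m : ℝ) = k + l := by exact_mod_cast hp.symm
        rw [ih k (by omega) (k - 1) (by linarith) (by linarith),
          ih l (by omega) (t - k) (by linarith) (by linarith), sub_self]
      · simp
      · simp
    have hm1 : (1 : ℝ) ≤ m := by exact_mod_cast hm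
    have hconst := hD (m - 1) (by linarith) (by linarith)
    intro t h0 ht
    have := hD t h0 ht
    exact sub_eq_zero.1 (show D t = 0 by linarith)

open Finset in
theorem factorial_mul_normalizedVolume (m : ℕ) (n : ℝ) :
    m.factorial * normalizedVolume m n = -(1 / 2 ^ m) * ∑ i ∈ Finset.range (m + 1),
        (m.choose i : ℝ) * (-(∏ k ∈ Finset.range i, (2 * (k : ℝ) - 1))) *
          (2 * n + 1) ^ (m - i) := by
  rw [normalizedVolume, Finset.mul_sum, Finset.mul_sum,
    ← Finset.Nat.sum_antidiagonal_eq_sum_range_succ (fun i j => -(1 / 2 ^ m) *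
      ((m.choose i : ℝ) * (-(∏ k ∈ Finset.range i, (2 * (k : ℝ) - 1))) * (2 * n + 1) ^ j))]
  refine Finset.sum_congr rfl fun p hp => ?_
  rw [HasAntidiagonal.mem_antidiagonal] at hp
  have h1 : ∏ k ∈ Finset.range p.1, (2 * (k : ℝ) - 1) =
      2 ^ p.1 * ∏ k ∈ Finset.range p.1, ((k : ℝ) - 1 / 2) := by
    rw [← Finset.card_range p.1, ← Finset.prod_const, Finset.card_range,
      ← Finset.prod_mul_distrib]
    exact Finset.prod_congr rfl fun k _ => by ring
  have h2 : (2 * n + 1) ^ p.2 = 2 ^ p.2 * (n + 1 / 2) ^ p.2 := by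
    rw [← mul_pow]; ring
  rw [← hp, Nat.cast_add_choose, h1, h2, sqrtCoeff, pow_add]
  field_simp
  ring_nf

/-- for `n ≥ m-1`, the (m-dimensional Lebesgue) volume of `P(m,n)` equals
`-(1/2^m) ∑_{i=0}^m binom(m,i)·(2i-3)!!·(2n+1)^{m-i}`, where
`(2i-3)!! = -∏_{k=1}^i (2k-3)`. -/
theorem volume_partialPermutohedron (m n : ℕ) (hm : 1 ≤ m) (hn : m ≤ n + 1) :
    (MeasureTheory.volume (partialPermutohedron m n)).toReal =
      -(1 / 2 ^ m) * ∑ i ∈ Finset.range (m + 1),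
        (m.choose i : ℝ) * (-(∏ k ∈ Finset.range i, (2 * (k : ℝ) - 1))) *
          (2 * (n : ℝ) + 1) ^ (m - i) := by
  have hn' : (m : ℝ) ≤ n + 1 := by exact_mod_cast hn
  rw [← factorial_mul_normalizedVolume,
    ← polymatroidVolume_div_factorial m n (Nat.cast_nonneg n) hn',
    partialPermutohedron_eq_polymatroid hn, mul_div_cancel₀ _ (by positivity), polymatroidVolume,
    measureReal_def]
end
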